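/- arXiv:2603.02037 — 2 statements merged into one kernel-verified Lean document; each statement's English description precedes it below -/
import Mathlib

section
/- For every positive integer l and every partition A of length at most l, there exists a positive integer N_A such that for every integer n ≥ N_A and every partition B of length at most l with weight n|A| that is dominated by nA (B ⪯ nA in the dominance order), the multiplicity of B in the n-th power (s_A)^n of the Schur function s_A is positive. -/
open Finset MvPolynomial

/-- `hp l k` is the complete homogeneous symmetric polynomial `h_k` in `l` variables,
interpreted as `0` for negative `k` (and `h_0 = 1`). -/
noncomputable def hp (l : ℕ) (k : ℤ) : MvPolynomial (Fin l) ℤ :=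
  if 0 ≤ k then MvPolynomial.hsymm (Fin l) ℤ k.toNat else 0

/-- The Schur polynomial of a partition (given as a weakly decreasing `l`-tuple) in `l`
variables, defined by the Jacobi–Trudi determinant `s_A = det (h_{A i - i + j})`. -/
noncomputable def schur (l : ℕ) (A : Fin l → ℕ) : MvPolynomial (Fin l) ℤ :=
  Matrix.det (Matrix.of fun i j : Fin l => hp l ((A i : ℤ) + (j : ℕ) - (i : ℕ)))

/-- The Vandermonde alternant `a_δ = det (x_i ^ (l - 1 - j))`. -/
noncomputable def vdm (l : ℕ) : MvPolynomial (Fin l) ℤ :=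
  Matrix.det (Matrix.of fun i j : Fin l => (X i : MvPolynomial (Fin l) ℤ) ^ (l - 1 - (j : ℕ)))

/-- The multiplicity (coefficient) of the Schur polynomial `s_B` in the expansion of a
symmetric polynomial `P` in the basis of Schur polynomials of partitions of length at most
`l`: it equals the coefficient of the monomial `x ^ (B + δ)` in the alternating polynomial
`P * a_δ`, where `δ = (l-1, l-2, …, 0)`. -/
noncomputable def schurMult (l : ℕ) (B : Fin l → ℕ) (P : MvPolynomial (Fin l) ℤ) : ℤ :=
  MvPolynomial.coeff (Finsupp.equivFunOnFinite.symm fun i : Fin l => B i + (l - 1 - (i : ℕ)))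
    (P * vdm l)

/-- The Littlewood–Richardson coefficient `c^C_{A,B}` for partitions of length at most `l`,
as the multiplicity of `s_C` in `s_A * s_B` (this agrees with the structure constants of the
ring of symmetric functions in the Schur basis). -/
noncomputable def lrCoeff (l : ℕ) (A B C : Fin l → ℕ) : ℤ :=
  schurMult l C (schur l A * schur l B)

/-- Dominance: every partial sum of `A` is at least the corresponding partial sum of `B`. -/
def Dom (l : ℕ) (A B : Fin l → ℕ) : Prop :=
  ∀ r : ℕ, ∑ i ∈ Finset.univ.filter (fun i : Fin l => (i : ℕ) < r), B i ≤
    ∑ i ∈ Finset.univ.filter (fun i : Fin l => (i : ℕ) < r), A i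

/-- The Young diagram of `A` (0-based): boxes `(i, j)` with `j < A i`. -/
def YD (l : ℕ) (A : Fin l → ℕ) : Set (Fin l × ℕ) := {p | p.2 < A p.1}

/-- the alternant with exponents `v`. -/
noncomputable def alt (l : ℕ) (v : Fin l → ℕ) : MvPolynomial (Fin l) ℤ :=
  Matrix.det (Matrix.of fun i j : Fin l => (X i : MvPolynomial (Fin l) ℤ) ^ (v j))

/-- the staircase. -/
def dl (l : ℕ) (i : Fin l) : ℕ := l - 1 - (i : ℕ)

/-- exponent vector as a finsupp. -/
noncomputable def fs {l : ℕ} (v : Fin l → ℕ) : Fin l →₀ ℕ := Finsupp.equivFunOnFinite.symm v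

theorem fs_apply {l : ℕ} (v : Fin l → ℕ) (i : Fin l) : fs v i = v i := rfl

theorem vdm_eq_alt (l : ℕ) : vdm l = alt l (dl l) := rfl

theorem prod_X_pow {l : ℕ} (v : Fin l → ℕ) :
    (∏ i, (X i : MvPolynomial (Fin l) ℤ) ^ v i) = monomial (fs v) 1 := by
  rw [MvPolynomial.monomial_eq]
  simp [Finsupp.prod_fintype, fs]

theorem alt_eq_sum (l : ℕ) (v : Fin l → ℕ) :
    alt l v = ∑ σ : Equiv.Perm (Fin l), ((Equiv.Perm.sign σ : ℤ) : MvPolynomial (Fin l) ℤ) *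
      monomial (fs (v ∘ σ)) 1 := by
  rw [alt, ← Matrix.det_transpose, Matrix.det_apply']
  refine Finset.sum_congr rfl fun σ _ => ?_
  congr 1
  rw [← prod_X_pow]
  rfl

theorem alt_perm (l : ℕ) (v : Fin l → ℕ) (σ : Equiv.Perm (Fin l)) :
    alt l (v ∘ σ) = ((Equiv.Perm.sign σ : ℤ) : MvPolynomial (Fin l) ℤ) * alt l v := by
  rw [alt, alt, ← Matrix.det_permute']
  rfl

open scoped Classical in
theorem coeff_mul_alt (l : ℕ) (P : MvPolynomial (Fin l) ℤ) (u v : Fin l → ℕ) :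
    coeff (fs u) (P * alt l v) = ∑ σ : Equiv.Perm (Fin l), (Equiv.Perm.sign σ : ℤ) *
      (if v ∘ σ ≤ u then coeff (fs (u - v ∘ σ)) P else 0) := by
  rw [alt_eq_sum, Finset.mul_sum, MvPolynomial.coeff_sum]
  refine Finset.sum_congr rfl fun σ _ => ?_
  have : P * (((Equiv.Perm.sign σ : ℤ) : MvPolynomial (Fin l) ℤ) * monomial (fs (v ∘ σ)) 1)
      = C ((Equiv.Perm.sign σ : ℤ)) * (P * monomial (fs (v ∘ σ)) 1) := by
    simp only [eq_intCast]; ring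
  rw [this, coeff_C_mul, coeff_mul_monomial']
  congr 1
  simp only [mul_one]
  have e : fs u - fs (v ∘ σ) = fs (u - v ∘ σ) := by
    ext i
    rfl
  rw [e]
  exact if_congr Iff.rfl rfl rfl

/-! Jacobi–Trudi -/

theorem hsymm_eq_coeff (l n : ℕ) :
    hsymm (Fin l) ℤ n = PowerSeries.coeff n
      (∏ p : Fin l, PowerSeries.mk fun n => (X p : MvPolynomial (Fin l) ℤ) ^ n) := by
  rw [PowerSeries.coeff_prod, hsymm]
  simp only [PowerSeries.coeff_mk]
  refine Finset.sum_bij (fun s _ => Multiset.toFinsupp s.1) ?_ ?_ ?_ ?_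
  · intro s _
    simp only [mem_finsuppAntidiag, Finset.subset_univ, and_true]
    have h := s.2
    have h2 : ∑ i, Multiset.count i s.1 = n := by
      rw [Multiset.sum_count_eq_card (fun a _ => Finset.mem_univ a)]
      exact h
    exact h2
  · intro s _ t _ h
    exact Subtype.ext (Multiset.toFinsupp.injective h)
  · intro f hf
    simp only [mem_finsuppAntidiag, Finset.subset_univ, and_true] at hf
    refine ⟨⟨Finsupp.toMultiset f, ?_⟩, Finset.mem_univ _, ?_⟩
    · rw [Finsupp.card_toMultiset, Finsupp.sum_fintype _ _ (fun _ => rfl)]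
      exact hf
    · simp
  · intro s _
    rw [Finset.prod_multiset_map_count]
    simp only [Multiset.toFinsupp_apply]
    apply Finset.prod_subset (Finset.subset_univ _)
    intro p _ hp
    simp only [Multiset.mem_toFinset] at hp
    rw [Multiset.count_eq_zero_of_notMem hp, pow_zero]

/-- `∏_{p ≠ m} (1 - x_p t)`. -/
noncomputable def epoly (l : ℕ) (m : Fin l) : Polynomial (MvPolynomial (Fin l) ℤ) :=
  ∏ p ∈ Finset.univ.erase m, (1 - Polynomial.C (X p) * Polynomial.X)

theorem epoly_coeff (l : ℕ) (m : Fin l) (n : ℕ) (hn : l ≤ n) : (epoly l m).coeff n = 0 := by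
  apply Polynomial.coeff_eq_zero_of_natDegree_lt
  refine lt_of_le_of_lt (Polynomial.natDegree_prod_le _ _) ?_
  refine lt_of_le_of_lt (Finset.sum_le_card_nsmul _ _ 1 ?_) ?_
  · intro p _
    compute_degree
  · have := m.2
    simp [Finset.card_erase_of_mem]
    omega

theorem geo_mul (l : ℕ) (p : Fin l) :
    (PowerSeries.mk fun n => (X p : MvPolynomial (Fin l) ℤ) ^ n) *
      (1 - PowerSeries.C (X p) * PowerSeries.X) = 1 := by
  ext1 n
  rw [mul_sub, mul_one, ← mul_assoc, map_sub]
  cases n with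
  | zero => simp
  | succ n =>
    rw [PowerSeries.coeff_succ_mul_X, mul_comm, PowerSeries.coeff_C_mul]
    simp [PowerSeries.coeff_one, pow_succ']

theorem jt_row (l : ℕ) (m : Fin l) (n : ℕ) :
    ∑ b ∈ range l, hp l ((n : ℤ) - b) * (epoly l m).coeff b = X m ^ n := by
  have h1 : (∏ p : Fin l, PowerSeries.mk fun n => (X p : MvPolynomial (Fin l) ℤ) ^ n) *
      ((epoly l m : Polynomial _) : PowerSeries _) =
      PowerSeries.mk fun n => (X m : MvPolynomial (Fin l) ℤ) ^ n := by
    rw [← Finset.mul_prod_erase _ _ (Finset.mem_univ m), mul_assoc]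
    have : ((epoly l m : Polynomial _) : PowerSeries _) = ∏ p ∈ Finset.univ.erase m,
      (1 - PowerSeries.C (X p : MvPolynomial (Fin l) ℤ) * PowerSeries.X) := by
      rw [epoly, ← Polynomial.coeToPowerSeries.ringHom_apply, map_prod]
      refine Finset.prod_congr rfl fun p _ => ?_
      simp
    rw [this, ← Finset.prod_mul_distrib]
    simp [geo_mul]
  have h2 := congrArg (PowerSeries.coeff n) h1
  rw [PowerSeries.coeff_mk, PowerSeries.coeff_mul] at h2
  rw [← h2, Finset.Nat.sum_antidiagonal_eq_sum_range_succ_mk, ← Finset.sum_range_reflect _ (n+1)]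
  simp only [← hsymm_eq_coeff, Polynomial.coeff_coe]
  have key : ∀ b ∈ range (n+1), hsymm (Fin l) ℤ (n + 1 - 1 - b) * (epoly l m).coeff (n - (n + 1 - 1 - b)) = hp l ((n : ℤ) - b) * (epoly l m).coeff b := by
    intro b hb
    have hb' : b ≤ n := by simpa [Nat.lt_succ_iff] using hb
    have e1 : n - (n + 1 - 1 - b) = b := by omega
    rw [e1, hp, if_pos (by omega)]
    congr 2
    omega
  rw [Finset.sum_congr rfl key]
  have A1 : ∑ b ∈ range l, hp l ((n : ℤ) - b) * (epoly l m).coeff b = ∑ b ∈ range (max l (n+1)), hp l ((n : ℤ) - b) * (epoly l m).coeff b := by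
    apply Finset.sum_subset (by simp)
    intro b _ hb
    rw [epoly_coeff l m b (by simpa using hb), mul_zero]
  have A2 : ∑ b ∈ range (n+1), hp l ((n : ℤ) - b) * (epoly l m).coeff b = ∑ b ∈ range (max l (n+1)), hp l ((n : ℤ) - b) * (epoly l m).coeff b := by
    apply Finset.sum_subset (by simp)
    intro b _ hb
    simp at hb
    rw [hp, if_neg (by omega), zero_mul]
  rw [A1, A2]

theorem jt_mul (l : ℕ) (A : Fin l → ℕ) :
    alt l (fun i => A i + dl l i) = schur l A *
      Matrix.det (Matrix.of fun j m : Fin l => (epoly l m).coeff (l - 1 - (j : ℕ))) := by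
  rw [schur, ← Matrix.det_mul, alt, ← Matrix.det_transpose]
  congr 1
  ext1 i m
  simp only [Matrix.transpose_apply, Matrix.of_apply, Matrix.mul_apply]
  rw [← jt_row, ← Finset.sum_range_reflect, Finset.sum_range]
  refine Finset.sum_congr rfl fun j _ => ?_
  have := j.2
  have := i.2
  congr 2
  simp only [dl]
  omega

theorem schur_zero (l : ℕ) : schur l (fun _ => 0) = 1 := by
  rw [schur, Matrix.det_of_isUpperTriangular]
  · apply Finset.prod_eq_one
    intro i _
    simp [hp]
  · intro i j hij
    simp only [id] at hij
    simp only [Matrix.of_apply, hp]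
    rw [if_neg]
    have : (j : ℕ) < i := hij
    simp; omega

theorem schur_mul_vdm (l : ℕ) (A : Fin l → ℕ) :
    schur l A * vdm l = alt l (fun i => A i + dl l i) := by
  have h0 := jt_mul l (fun _ => 0)
  rw [schur_zero, one_mul] at h0
  rw [jt_mul, ← h0, vdm_eq_alt]
  simp

section

/-- Gelfand–Tsetlin patterns with top row `A`. -/
structure IsGT (l : ℕ) (A : ℕ → ℕ) (x : ℕ → ℕ → ℕ) : Prop where
  z : ∀ k i, k ≤ i → x k i = 0
  up : ∀ k i, x k i ≤ x (k+1) i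
  dn : ∀ k i, x (k+1) (i+1) ≤ x k i
  top : ∀ k i, l ≤ k → x k i = A i

theorem IsGT.le_A {l : ℕ} {A : ℕ → ℕ} {x : ℕ → ℕ → ℕ} (h : IsGT l A x) (k i : ℕ) :
    x k i ≤ A i := by
  have mono : Monotone fun k => x k i := monotone_nat_of_le_succ fun k => h.up k i
  calc x k i ≤ x (max k l) i := mono (le_max_left _ _)
    _ = A i := h.top _ _ (le_max_right _ _)

theorem gt_finite (l : ℕ) (A : ℕ → ℕ) : {x | IsGT l A x}.Finite := by
  apply Set.Finite.of_finite_image (f := fun x (k i : Fin l) => x (k : ℕ) (i : ℕ))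
  · apply Set.Finite.subset (Set.finite_Iic (fun (_ i : Fin l) => A i))
    rintro _ ⟨x, hx, rfl⟩
    intro k i
    exact IsGT.le_A hx k i
  · intro x hx y hy hxy
    funext k i
    by_cases hk : k < l
    · by_cases hi : i < l
      · exact congrFun (congrFun hxy ⟨k, hk⟩) ⟨i, hi⟩
      · rw [hx.z k i (by omega), hy.z k i (by omega)]
    · rw [hx.top k i (by omega), hy.top k i (by omega)]

/-- Finset of Gelfand–Tsetlin patterns. -/
noncomputable def gts (l : ℕ) (A : ℕ → ℕ) : Finset (ℕ → ℕ → ℕ) := (gt_finite l A).toFinset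

theorem mem_gts {l : ℕ} {A : ℕ → ℕ} {x : ℕ → ℕ → ℕ} : x ∈ gts l A ↔ IsGT l A x := by
  simp [gts]

/-- boxes with letters `< k` in columns `> c`. -/
def gG (l : ℕ) (x : ℕ → ℕ → ℕ) (c k : ℕ) : ℕ := ∑ i ∈ range l, (x k i - c)

/-- boxes with letters `< k` in columns `≤ c`. -/
def gH (l : ℕ) (x : ℕ → ℕ → ℕ) (c k : ℕ) : ℕ := ∑ i ∈ range l, min c (x k i)

/-- height of the column `c+1` restricted to letters `< k`. -/
def gN (l : ℕ) (x : ℕ → ℕ → ℕ) (c k : ℕ) : ℕ := ∑ i ∈ range l, (if c < x k i then 1 else 0)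

/-- content of the columns `> c`. -/
def gc (l : ℕ) (x : ℕ → ℕ → ℕ) (c k : ℕ) : ℕ := gG l x c (k+1) - gG l x c k

theorem gG_add_gH (l x c k) : gG l x c k + gH l x c k = gG l x 0 k := by
  simp only [gG, gH, ← Finset.sum_add_distrib]
  refine Finset.sum_congr rfl fun i _ => ?_
  omega

theorem gG_succ (l x c k) : gG l x c k = gG l x (c+1) k + gN l x c k := by
  simp only [gG, gN, ← Finset.sum_add_distrib]
  refine Finset.sum_congr rfl fun i _ => ?_
  split_ifs <;> omega

variable {l : ℕ} {A : ℕ → ℕ} {x : ℕ → ℕ → ℕ}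

theorem IsGT.gG_mono (h : IsGT l A x) (c k : ℕ) : gG l x c k ≤ gG l x c (k+1) := by
  apply Finset.sum_le_sum
  intro i _
  have := h.up k i
  omega

theorem IsGT.gH_mono (h : IsGT l A x) (c k : ℕ) : gH l x c k ≤ gH l x c (k+1) := by
  apply Finset.sum_le_sum
  intro i _
  have := h.up k i
  omega

theorem IsGT.gN_mono (h : IsGT l A x) (c k : ℕ) : gN l x c k ≤ gN l x c (k+1) := by
  apply Finset.sum_le_sum
  intro i _
  have := h.up k i
  split_ifs <;> omega

theorem IsGT.gN_le (h : IsGT l A x) (c k : ℕ) : gN l x c (k+1) ≤ gN l x c k + 1 := by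
  have h1 : ∀ m, ∑ i ∈ range (m+1), (if c < x (k+1) i then 1 else 0) ≤
      ∑ i ∈ range m, (if c < x k i then 1 else 0) + 1 := by
    intro m
    rw [Finset.sum_range_succ']
    have : ∑ i ∈ range m, (if c < x (k+1) (i+1) then 1 else 0) ≤
      ∑ i ∈ range m, (if c < x k i then 1 else 0) := by
      apply Finset.sum_le_sum
      intro i _
      have := h.dn k i
      split_ifs <;> omega
    split_ifs <;> omega
  refine le_trans ?_ (h1 l)
  apply Finset.sum_le_sum_of_subset
  simp

theorem IsGT.pt_of_gN (h : IsGT l A x) (c k : ℕ) (hk : k + 1 < l) (e : gN l x c (k+1) = gN l x c k) (i : ℕ)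
    (hi : c < x (k+1) i) : c < x k i := by
  have hle : ∀ i ∈ range l, (if c < x k i then 1 else 0) ≤ (if c < x (k+1) i then 1 else 0) := by
    intro i _
    have := h.up k i
    split_ifs <;> omega
  have := (Finset.sum_eq_sum_iff_of_le hle).1 e.symm
  have hil : i < l := by
    by_contra hc
    rw [h.z (k+1) i (by omega)] at hi
    omega
  have := this i (by simpa using hil)
  rw [if_pos hi] at this
  by_contra hc
  rw [if_neg hc] at this
  omega

/-- shifted lower row. -/
def pv (x : ℕ → ℕ → ℕ) (c s : ℕ) : ℕ → ℕ
  | 0 => c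
  | i+1 => x s i

/-- upper bound for toggling. -/
def hiB (x : ℕ → ℕ → ℕ) (c s i : ℕ) : ℕ := min (min c (x (s+2) i)) (pv x c s i)

/-- lower bound for toggling. -/
def loB (x : ℕ → ℕ → ℕ) (c s i : ℕ) : ℕ := max (min c (x (s+2) (i+1))) (min c (x s i))

/-- Bender–Knuth toggle of row `s+1` on the columns `≤ c`. -/
def tog (c s : ℕ) (x : ℕ → ℕ → ℕ) : ℕ → ℕ → ℕ := fun k i =>
  if k = s + 1 ∧ x (s+1) i ≤ c then hiB x c s i + loB x c s i - x (s+1) i else x k i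

theorem tog_ne (c s : ℕ) (x : ℕ → ℕ → ℕ) (k i : ℕ) (hk : k ≠ s + 1) : tog c s x k i = x k i := by
  simp [tog, hk]

theorem tog_le (c s : ℕ) (x : ℕ → ℕ → ℕ) (i : ℕ) (hk : x (s+1) i ≤ c) :
    tog c s x (s+1) i = hiB x c s i + loB x c s i - x (s+1) i := by
  simp [tog, hk]

theorem tog_gt (c s : ℕ) (x : ℕ → ℕ → ℕ) (i : ℕ) (hk : c < x (s+1) i) :
    tog c s x (s+1) i = x (s+1) i := by
  simp [tog, hk]

theorem IsGT.bounds (h : IsGT l A x) (c s i : ℕ) (hk : x (s+1) i ≤ c) :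
    loB x c s i ≤ x (s+1) i ∧ x (s+1) i ≤ hiB x c s i := by
  have h1 := h.up s i
  have h2 : x (s+1) i ≤ x (s+2) i := h.up (s+1) i
  have h3 : x (s+2) (i+1) ≤ x (s+1) i := h.dn (s+1) i
  cases i with
  | zero => simp only [loB, hiB, pv]; omega
  | succ i =>
    have h4 := h.dn s i
    simp only [loB, hiB, pv]; omega

theorem IsGT.tog_bounds (h : IsGT l A x) (c s i : ℕ) (hk : x (s+1) i ≤ c) :
    loB x c s i ≤ tog c s x (s+1) i ∧ tog c s x (s+1) i ≤ hiB x c s i := by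
  have := h.bounds c s i hk
  rw [tog_le _ _ _ _ hk]
  omega

theorem hiB_le (x : ℕ → ℕ → ℕ) (c s i : ℕ) : hiB x c s i ≤ c := by
  simp only [hiB]; omega

theorem IsGT.tog_gt_iff (h : IsGT l A x) (c s i : ℕ) :
    tog c s x (s+1) i ≤ c ↔ x (s+1) i ≤ c := by
  constructor
  · intro h1
    by_contra h2
    rw [tog_gt _ _ _ _ (by omega)] at h1
    exact h2 h1
  · intro h1
    exact (h.tog_bounds c s i h1).2.trans (hiB_le _ _ _ _)

theorem hiB_tog (c s : ℕ) (x : ℕ → ℕ → ℕ) (i : ℕ) : hiB (tog c s x) c s i = hiB x c s i := by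
  cases i <;> simp [hiB, pv, tog]

theorem loB_tog (c s : ℕ) (x : ℕ → ℕ → ℕ) (i : ℕ) : loB (tog c s x) c s i = loB x c s i := by
  simp [loB, tog]

theorem IsGT.tog_tog (h : IsGT l A x) (c s : ℕ) : tog c s (tog c s x) = x := by
  funext k i
  by_cases hk : k = s + 1
  · subst hk
    by_cases hx : x (s+1) i ≤ c
    · rw [tog_le _ _ _ _ ((h.tog_gt_iff c s i).2 hx), hiB_tog, loB_tog, tog_le _ _ _ _ hx]
      have := h.bounds c s i hx
      omega
    · have : ¬ tog c s x (s+1) i ≤ c := by rwa [h.tog_gt_iff c s i]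
      rw [tog_gt _ _ _ _ (by omega), tog_gt _ _ _ _ (by omega)]
  · rw [tog_ne _ _ _ _ _ hk, tog_ne _ _ _ _ _ hk]

theorem IsGT.tog (h : IsGT l A x) (c s : ℕ) (hs : s + 1 < l) : IsGT l A (tog c s x) := by
  have key : ∀ i, x s i ≤ _root_.tog c s x (s+1) i ∧ _root_.tog c s x (s+1) i ≤ x (s+2) i ∧
      x (s+2) (i+1) ≤ _root_.tog c s x (s+1) i := by
    intro i
    have h1 := h.up s i
    have h2 := h.up (s+1) i
    have h3 := h.dn (s+1) i
    by_cases hx : x (s+1) i ≤ c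
    · have := h.tog_bounds c s i hx
      simp only [loB, hiB] at this
      have h3' : x (s+2) (i+1) ≤ x (s+1) i := h3
      omega
    · rw [tog_gt _ _ _ _ (by omega)]
      exact ⟨h1, h2, h3⟩
  have key2 : ∀ i, _root_.tog c s x (s+1) (i+1) ≤ x s i := by
    intro i
    by_cases hx : x (s+1) (i+1) ≤ c
    · have := h.tog_bounds c s (i+1) hx
      simp only [hiB, pv] at this
      omega
    · rw [tog_gt _ _ _ _ (by omega)]
      exact h.dn s i
  refine ⟨?_, ?_, ?_, ?_⟩
  · intro k i hki
    by_cases hk : k = s + 1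
    · subst hk
      obtain ⟨i, rfl⟩ : ∃ j, i = j + 1 := ⟨i - 1, by omega⟩
      have := key2 i
      rw [h.z s i (by omega)] at this
      omega
    · rw [tog_ne _ _ _ _ _ hk]; exact h.z k i hki
  · intro k i
    by_cases hk : k = s + 1
    · subst hk
      rw [tog_ne _ _ _ (s+1+1) _ (by omega)]
      exact (key i).2.1
    · rw [tog_ne _ _ _ _ _ hk]
      by_cases hk2 : k = s
      · subst hk2; exact (key i).1
      · rw [tog_ne _ _ _ _ _ (by omega)]; exact h.up k i
  · intro k i
    by_cases hk : k = s + 1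
    · subst hk
      rw [tog_ne _ _ _ (s+1+1) _ (by omega)]
      exact (key i).2.2
    · rw [tog_ne _ _ _ k _ hk]
      by_cases hk2 : k = s
      · subst hk2; exact key2 i
      · rw [tog_ne _ _ _ _ _ (by omega)]; exact h.dn k i
  · intro k i hk
    rw [tog_ne _ _ _ _ _ (by omega)]
    exact h.top k i hk

theorem IsGT.gG_tog (h : IsGT l A x) (c s k c' : ℕ) (hc : c ≤ c') :
    gG l (_root_.tog c s x) c' k = gG l x c' k := by
  refine Finset.sum_congr rfl fun i _ => ?_
  by_cases hk : k = s + 1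
  · subst hk
    by_cases hx : x (s+1) i ≤ c
    · have := (h.tog_gt_iff c s i).2 hx
      omega
    · rw [tog_gt _ _ _ _ (by omega)]
  · rw [tog_ne _ _ _ _ _ hk]

theorem sum_hi_lo (x : ℕ → ℕ → ℕ) (c s m : ℕ) :
    ∑ i ∈ range (m+1), hiB x c s i + ∑ i ∈ range m, loB x c s i =
    ∑ i ∈ range (m+1), min c (x (s+2) i) + ∑ i ∈ range m, min c (x s i) := by
  induction m with
  | zero => simp [hiB, pv, min_comm]
  | succ m ih =>
    rw [Finset.sum_range_succ _ (m+1), Finset.sum_range_succ (fun i => loB x c s i),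
      Finset.sum_range_succ (fun i => min c (x (s+2) i)) (m+1),
      Finset.sum_range_succ (fun i => min c (x s i)) m]
    have : hiB x c s (m+1) + loB x c s m = min c (x (s+2) (m+1)) + min c (x s m) := by
      simp only [hiB, loB, pv]; omega
    omega

theorem IsGT.gH_tog (h : IsGT l A x) (c s : ℕ) (hs : s + 1 < l)
    (hp : ∀ i, c < x (s+1) i → c < x s i) :
    gH l (_root_.tog c s x) c (s+1) + gH l x c (s+1) = gH l x c (s+2) + gH l x c s := by
  obtain ⟨m, rfl⟩ : ∃ m, l = m + 1 := ⟨l - 1, by omega⟩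
  have h1 : gH (m+1) (_root_.tog c s x) c (s+1) + gH (m+1) x c (s+1) =
      ∑ i ∈ range (m+1), (hiB x c s i + loB x c s i) := by
    rw [gH, gH, ← Finset.sum_add_distrib]
    refine Finset.sum_congr rfl fun i _ => ?_
    by_cases hx : x (s+1) i ≤ c
    · have h3 := (h.tog_gt_iff c s i).2 hx
      rw [min_eq_right h3, min_eq_right hx, tog_le _ _ _ _ hx]
      have := h.bounds c s i hx
      omega
    · rw [tog_gt _ _ _ _ (by omega)]
      have h2 := hp i (by omega)
      have h3 : x (s+1) i ≤ x (s+2) i := h.up (s+1) i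
      cases i with
      | zero => simp only [hiB, loB, pv]; omega
      | succ i =>
        have h4 := h.dn s i
        simp only [hiB, loB, pv]; omega
  rw [h1, Finset.sum_add_distrib, Finset.sum_range_succ (fun i => loB x c s i), ← add_assoc, sum_hi_lo]
  have h2 : loB x c s m = 0 := by
    simp only [loB]
    rw [h.z s m (by omega), h.top (s+2) (m+1) |> fun _ => h.z (s+2) (m+1) (by omega)]
    simp
  rw [h2, gH, gH, Finset.sum_range_succ (fun i => min c (x s i)), h.z s m (by omega)]
  simp

end

/-- weight of a pattern. -/
def wt (l : ℕ) (x : ℕ → ℕ → ℕ) (k : Fin l) : ℕ := gc l x 0 k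

theorem IsGT.gc_tog {l : ℕ} {A : ℕ → ℕ} {x : ℕ → ℕ → ℕ} (h : IsGT l A x) (c s c' k : ℕ)
    (hc : c ≤ c') : gc l (_root_.tog c s x) c' k = gc l x c' k := by
  simp only [gc, h.gG_tog c s _ c' hc]

theorem IsGT.wt_tog {l : ℕ} {A : ℕ → ℕ} {x : ℕ → ℕ → ℕ} (h : IsGT l A x) (c s : ℕ) (hs : s + 1 < l)
    (hp : ∀ i, c < x (s+1) i → c < x s i) :
    gc l (_root_.tog c s x) 0 s + gc l x c (s+1) = gc l x 0 (s+1) + gc l x c s ∧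
    gc l (_root_.tog c s x) 0 (s+1) + gc l x c s = gc l x 0 s + gc l x c (s+1) ∧
    ∀ k, k ≠ s → k ≠ s + 1 → gc l (_root_.tog c s x) 0 k = gc l x 0 k := by
  have h' := h.tog c s hs
  have row : ∀ k c', k ≠ s + 1 → gG l (_root_.tog c s x) c' k = gG l x c' k := by
    intro k c' hk
    simp only [gG, tog_ne c s x k _ hk]
  have a1 := h.gH_tog c s hs hp
  have a2 := gG_add_gH l x c s
  have a3 := gG_add_gH l x c (s+1)
  have a4 := gG_add_gH l x c (s+2)
  have a5 := gG_add_gH l (_root_.tog c s x) c (s+1)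
  have a6 := h.gG_tog c s (s+1) c le_rfl
  have b1 := h.gG_mono c s
  have b2 : gG l x c (s+1) ≤ gG l x c (s+2) := h.gG_mono c (s+1)
  have b3 := h.gH_mono c s
  have b4 : gH l x c (s+1) ≤ gH l x c (s+2) := h.gH_mono c (s+1)
  have b5 := h'.gG_mono 0 s
  have b6 : gG l (_root_.tog c s x) 0 (s+1) ≤ gG l (_root_.tog c s x) 0 (s+2) := h'.gG_mono 0 (s+1)
  have c1 := row s 0 (by omega)
  have c2 := row (s+2) 0 (by omega)
  refine ⟨?_, ?_, ?_⟩
  · simp only [gc, show s + 1 + 1 = s + 2 from rfl]; omega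
  · simp only [gc, show s + 1 + 1 = s + 2 from rfl]; omega
  · intro k h1 h2
    simp only [gc]
    rw [row k 0 h2, row (k+1) 0 (by omega)]

/-- generating function of patterns. -/
noncomputable def gtp (l : ℕ) (A : ℕ → ℕ) : MvPolynomial (Fin l) ℤ :=
  ∑ x ∈ gts l A, monomial (fs (wt l x)) 1

theorem swap_fun {l : ℕ} (s : ℕ) (hs : s + 1 < l) (u v : Fin l → ℕ)
    (h1 : v ⟨s, by omega⟩ = u ⟨s+1, hs⟩) (h2 : v ⟨s+1, hs⟩ = u ⟨s, by omega⟩)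
    (h3 : ∀ k : Fin l, (k : ℕ) ≠ s → (k : ℕ) ≠ s + 1 → v k = u k) :
    v = u ∘ Equiv.swap (⟨s, by omega⟩ : Fin l) ⟨s+1, hs⟩ := by
  funext k
  simp only [Function.comp]
  by_cases hk : (k : ℕ) = s
  · have : k = ⟨s, by omega⟩ := Fin.ext hk
    rw [this, Equiv.swap_apply_left, h1]
  · by_cases hk2 : (k : ℕ) = s + 1
    · have : k = ⟨s+1, hs⟩ := Fin.ext hk2
      rw [this, Equiv.swap_apply_right, h2]
    · rw [Equiv.swap_apply_of_ne_of_ne, h3 k hk hk2]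
      · intro h; exact hk (by rw [h])
      · intro h; exact hk2 (by rw [h])

theorem IsGT.gG_big {l : ℕ} {A : ℕ → ℕ} {x : ℕ → ℕ → ℕ} (h : IsGT l A x) (c : ℕ) (hc : ∀ i, A i ≤ c) (k : ℕ) :
    gG l x c k = 0 := by
  simp only [gG]
  apply Finset.sum_eq_zero
  intro i _
  have := h.le_A k i
  have := hc i
  omega

theorem rename_mon {l : ℕ} (σ : Equiv.Perm (Fin l)) (v : Fin l → ℕ) :
    rename σ (monomial (fs v) (1:ℤ)) = monomial (fs (v ∘ (σ⁻¹ : Equiv.Perm (Fin l)))) 1 := by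
  rw [rename_monomial]
  suffices e : Finsupp.mapDomain σ (fs v) = fs (v ∘ (σ⁻¹ : Equiv.Perm (Fin l))) by rw [e]
  ext i
  rw [fs_apply]
  obtain ⟨j, rfl⟩ := σ.surjective i
  rw [Finsupp.mapDomain_apply σ.injective]
  simp [fs_apply]

theorem gtp_swap (l : ℕ) (A : ℕ → ℕ) (c : ℕ) (hc : ∀ i, A i ≤ c) (s : ℕ) (hs : s + 1 < l) :
    rename (Equiv.swap (⟨s, by omega⟩ : Fin l) ⟨s+1, hs⟩) (gtp l A) = gtp l A := by
  simp only [gtp, map_sum, rename_mon]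
  refine Finset.sum_nbij' (tog c s) (tog c s) ?_ ?_ ?_ ?_ ?_
  · intro x hx; rw [mem_gts] at *; exact hx.tog c s hs
  · intro x hx; rw [mem_gts] at *; exact hx.tog c s hs
  · intro x hx; rw [mem_gts] at hx; exact hx.tog_tog c s
  · intro x hx; rw [mem_gts] at hx; exact hx.tog_tog c s
  · intro x hx
    rw [mem_gts] at hx
    have := hx.wt_tog c s hs (by
      intro i hi
      have := hx.le_A (s+1) i
      have := hc i
      omega)
    have e : ∀ k, gc l x c k = 0 := by intro k; simp [gc, hx.gG_big c hc]
    rw [e, e] at this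
    rw [swap_fun s hs (wt l x) (wt l (tog c s x)) (by simpa [wt] using this.1) (by simpa [wt] using this.2.1)
      (by intro k h1 h2; exact this.2.2 k h1 h2)]
    simp

theorem gtp_symm (l : ℕ) (A : ℕ → ℕ) (c : ℕ) (hc : ∀ i, A i ≤ c) (σ : Equiv.Perm (Fin l)) :
    rename σ (gtp l A) = gtp l A := by
  cases l with
  | zero =>
    have : σ = 1 := Subsingleton.elim _ _
    subst this
    simp
  | succ n =>
    have hσ : σ ∈ Submonoid.closure (Set.range fun i : Fin n => Equiv.swap i.castSucc i.succ) := by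
      rw [Equiv.Perm.mclosure_swap_castSucc_succ]; trivial
    induction hσ using Submonoid.closure_induction with
    | mem x hx =>
      obtain ⟨i, rfl⟩ := hx
      exact gtp_swap (n+1) A c hc i (by omega)
    | one => simp
    | mul x y _ _ hx hy =>
      rw [Equiv.Perm.coe_mul, ← rename_rename, hy, hx]

theorem gtp_mul_alt (l : ℕ) (A : ℕ → ℕ) (c : ℕ) (hc : ∀ i, A i ≤ c) (v : Fin l → ℕ) :
    gtp l A * alt l v = ∑ x ∈ gts l A, alt l (v + wt l x) := by
  simp only [alt_eq_sum]
  rw [Finset.sum_comm, Finset.mul_sum]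
  refine Finset.sum_congr rfl fun σ _ => ?_
  rw [← Finset.mul_sum, mul_left_comm]
  congr 1
  rw [← gtp_symm l A c hc σ⁻¹, gtp, map_sum, Finset.sum_mul]
  refine Finset.sum_congr rfl fun x _ => ?_
  rw [rename_mon, monomial_mul, one_mul]
  have e : fs (wt l x ∘ ((σ⁻¹)⁻¹ : Equiv.Perm (Fin l))) + fs (v ∘ σ) = fs ((v + wt l x) ∘ σ) := by
    ext i
    simp only [Finsupp.add_apply, fs_apply, Function.comp, inv_inv, Pi.add_apply]
    omega
  rw [e]

/-- dominance of the partial content at column `c`. -/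
def gdAt (l : ℕ) (C : ℕ → ℕ) (x : ℕ → ℕ → ℕ) (c : ℕ) : Prop :=
  ∀ k, k + 1 < l → C (k+1) + gc l x c (k+1) ≤ C k + gc l x c k

theorem alt_cancel (l : ℕ) (s : ℕ) (hs : s + 1 < l) (u v : Fin l → ℕ)
    (h : v = u ∘ Equiv.swap (⟨s, by omega⟩ : Fin l) ⟨s+1, hs⟩) : alt l u + alt l v = 0 := by
  rw [h, alt_perm, Equiv.Perm.sign_swap]
  · simp
  · intro h; simp [Fin.ext_iff] at h

theorem IsGT.viol {l : ℕ} {A : ℕ → ℕ} {x : ℕ → ℕ → ℕ} (h : IsGT l A x) (C : ℕ → ℕ) (c s : ℕ)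
    (hs : s + 1 < l) (h1 : gdAt l C x (c+1))
    (h2 : C s + gc l x c s < C (s+1) + gc l x c (s+1)) :
    C s + gc l x c s + 1 = C (s+1) + gc l x c (s+1) ∧ ∀ i, c < x (s+1) i → c < x s i := by
  have a1 := h1 s hs
  have b0 := gG_succ l x c s
  have b1 := gG_succ l x c (s+1)
  have b2 := gG_succ l x c (s+2)
  have m0 := h.gN_mono c s
  have m1 : gN l x c (s+1) ≤ gN l x c (s+2) := h.gN_mono c (s+1)
  have n0 := h.gN_le c s
  have n1 : gN l x c (s+2) ≤ gN l x c (s+1) + 1 := h.gN_le c (s+1)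
  have d0 := h.gG_mono (c+1) s
  have d1 : gG l x (c+1) (s+1) ≤ gG l x (c+1) (s+2) := h.gG_mono (c+1) (s+1)
  simp only [gc, show s + 1 + 1 = s + 2 from rfl] at *
  refine ⟨by omega, ?_⟩
  exact h.pt_of_gN c s hs (by omega)

open scoped Classical in
theorem gt_step (l : ℕ) (A C : ℕ → ℕ) (c : ℕ) (v : Fin l → ℕ) (hv : ∀ k, v k = C k + dl l k) :
    ∑ x ∈ (gts l A).filter (fun x => ∀ c', c + 1 ≤ c' → gdAt l C x c'), alt l (v + wt l x) =
    ∑ x ∈ (gts l A).filter (fun x => ∀ c', c ≤ c' → gdAt l C x c'), alt l (v + wt l x) := by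
  have split := Finset.sum_filter_add_sum_filter_not
    ((gts l A).filter (fun x => ∀ c', c + 1 ≤ c' → gdAt l C x c')) (fun x => gdAt l C x c)
    (fun x => alt l (v + wt l x))
  rw [← split]
  have e1 : ((gts l A).filter (fun x => ∀ c', c + 1 ≤ c' → gdAt l C x c')).filter
      (fun x => gdAt l C x c) = (gts l A).filter (fun x => ∀ c', c ≤ c' → gdAt l C x c') := by
    ext x
    simp only [Finset.mem_filter]
    constructor
    · rintro ⟨⟨h1, h2⟩, h3⟩
      refine ⟨h1, fun c' hc' => ?_⟩
      rcases eq_or_lt_of_le hc' with h | h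
      · rw [← h]; exact h3
      · exact h2 c' h
    · rintro ⟨h1, h2⟩
      exact ⟨⟨h1, fun c' hc' => h2 c' (by omega)⟩, h2 c le_rfl⟩
  rw [e1]
  conv_rhs => rw [← add_zero (∑ x ∈ (gts l A).filter (fun x => ∀ c', c ≤ c' → gdAt l C x c'), alt l (v + wt l x))]
  congr 1
  let S : (ℕ → ℕ → ℕ) → Set ℕ := fun x => {k | k + 1 < l ∧ C k + gc l x c k < C (k+1) + gc l x c (k+1)}
  have hS : ∀ x, ¬ gdAt l C x c → sInf (S x) ∈ S x := by
    intro x hx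
    apply Nat.sInf_mem
    simp only [gdAt, not_forall, not_le] at hx
    obtain ⟨k, h1, h2⟩ := hx
    exact ⟨k, h1, h2⟩
  have hStog : ∀ x, IsGT l A x → ∀ s, S (tog c s x) = S x := by
    intro x hx s
    ext k
    simp only [S, Set.mem_ofPred_eq, hx.gc_tog c s c _ le_rfl]
  have gdtog : ∀ x, IsGT l A x → ∀ s c', c ≤ c' → (gdAt l C (tog c s x) c' ↔ gdAt l C x c') := by
    intro x hx s c' hc'
    simp only [gdAt, hx.gc_tog c s c' _ hc']
  have key : ∀ x ∈ ((gts l A).filter (fun x => ∀ c', c + 1 ≤ c' → gdAt l C x c')).filter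
      (fun x => ¬ gdAt l C x c), alt l (v + wt l x) + alt l (v + wt l (tog c (sInf (S x)) x)) = 0 := by
    intro x hx
    simp only [Finset.mem_filter, mem_gts] at hx
    obtain ⟨⟨h, h1⟩, h2⟩ := hx
    have hs := hS x h2
    obtain ⟨hs1, hs2⟩ := hs
    generalize sInf (S x) = s at *
    have w := h.viol C c s hs1 (h1 (c+1) le_rfl) hs2
    have t := h.wt_tog c s hs1 w.2
    apply alt_cancel l s hs1
    apply swap_fun s hs1
    · simp only [Pi.add_apply, hv, wt, dl]; omega
    · simp only [Pi.add_apply, hv, wt, dl]; omega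
    · intro k k1 k2
      simp only [Pi.add_apply, wt]
      rw [t.2.2 k k1 k2]
  refine Finset.sum_involution (fun x _ => tog c (sInf (S x)) x) key ?_ ?_ ?_
  · intro x hx hne heq
    have := key x hx
    rw [heq] at this
    have h2 : (2 : MvPolynomial (Fin l) ℤ) * alt l (v + wt l x) = 0 := by rw [two_mul]; exact this
    rcases mul_eq_zero.1 h2 with h3 | h3
    · exact two_ne_zero h3
    · exact hne h3
  · intro x hx
    simp only [Finset.mem_filter, mem_gts] at hx ⊢
    obtain ⟨⟨h, h1⟩, h2⟩ := hx
    refine ⟨⟨h.tog c _ (hS x h2).1, ?_⟩, ?_⟩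
    · intro c' hc'
      rw [gdtog x h _ c' (by omega)]
      exact h1 c' hc'
    · rwa [gdtog x h _ c le_rfl]
  · intro x hx
    simp only [Finset.mem_filter, mem_gts] at hx
    simp only [hStog x hx.1.1]
    exact hx.1.1.tog_tog c _

open scoped Classical in
theorem gtp_mul_alt_good (l : ℕ) (A C : ℕ → ℕ) (c : ℕ) (hc : ∀ i, A i ≤ c) (v : Fin l → ℕ)
    (hv : ∀ k, v k = C k + dl l k) (hC : ∀ k, k + 1 < l → C (k+1) ≤ C k) :
    gtp l A * alt l v =
    ∑ x ∈ (gts l A).filter (fun x => ∀ c', gdAt l C x c'), alt l (v + wt l x) := by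
  rw [gtp_mul_alt l A c hc]
  have h1 : ∀ m, ∑ x ∈ (gts l A).filter (fun x => ∀ c', m ≤ c' → gdAt l C x c'), alt l (v + wt l x) =
    ∑ x ∈ (gts l A).filter (fun x => ∀ c', gdAt l C x c'), alt l (v + wt l x) := by
    intro m
    induction m with
    | zero => simp
    | succ m ih => rw [gt_step l A C m v hv, ih]
  rw [← h1 c]
  congr 1
  symm
  rw [Finset.filter_eq_self]
  intro x hx c' hc'
  rw [mem_gts] at hx
  intro k hk
  have e : ∀ k, gc l x c' k = 0 := by
    intro k; simp [gc, hx.gG_big c' (fun i => (hc i).trans hc')]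
  rw [e, e]
  simpa using hC k hk

/-- extension of a tuple by zero. -/
def ex {l : ℕ} (A : Fin l → ℕ) (i : ℕ) : ℕ := if h : i < l then A ⟨i, h⟩ else 0

theorem ex_coe {l : ℕ} (A : Fin l → ℕ) (i : Fin l) : ex A i = A i := by simp [ex]

theorem ex_ge {l : ℕ} (A : Fin l → ℕ) (i : ℕ) (h : l ≤ i) : ex A i = 0 := by
  simp [ex, h]

theorem ex_anti {l : ℕ} {A : Fin l → ℕ} (hA : Antitone A) : Antitone (ex A) := by
  intro i j hij
  by_cases hj : j < l
  · simp only [ex, hj, dif_pos, lt_of_le_of_lt hij hj]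
    exact hA hij
  · simp [ex, hj]

theorem ex_bd {l : ℕ} {A : Fin l → ℕ} (hA : Antitone A) (i : ℕ) : ex A i ≤ ex A 0 :=
  ex_anti hA (Nat.zero_le _)

/-- the standard (highest weight) pattern. -/
def stdp (A : ℕ → ℕ) (k i : ℕ) : ℕ := if i < k then A i else 0

theorem stdp_gt {l : ℕ} {A : ℕ → ℕ} (hA : Antitone A) (h0 : ∀ i, l ≤ i → A i = 0) :
    IsGT l A (stdp A) where
  z k i h := by simp [stdp, h]
  up k i := by
    simp only [stdp]
    split_ifs <;> omega
  dn k i := by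
    have := hA (Nat.le_succ i)
    simp only [stdp]
    split_ifs <;> simp_all
  top k i h := by
    simp only [stdp]
    split_ifs with h1
    · rfl
    · rw [h0 i (by omega)]

theorem gG_stdp (l : ℕ) (A : ℕ → ℕ) (c k : ℕ) (hk : k < l) :
    gG l (stdp A) c (k+1) = gG l (stdp A) c k + (A k - c) := by
  simp only [gG]
  have : ∀ i ∈ range l, stdp A (k+1) i - c = (stdp A k i - c) + if i = k then A k - c else 0 := by
    intro i _
    simp only [stdp]
    by_cases h1 : i < k
    · rw [if_pos (by omega), if_pos h1, if_neg (by omega)]; rfl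
    · by_cases h2 : i = k
      · subst h2; simp
      · rw [if_neg (by omega), if_neg h1, if_neg h2]; rfl
  rw [Finset.sum_congr rfl this, Finset.sum_add_distrib]
  simp [hk]

theorem gc_stdp (l : ℕ) (A : ℕ → ℕ) (c k : ℕ) (hk : k < l) :
    gc l (stdp A) c k = A k - c := by
  rw [gc, gG_stdp l A c k hk]; omega

theorem good_std {l : ℕ} {A : ℕ → ℕ} {x : ℕ → ℕ → ℕ} (h : IsGT l A x)
    (hg : ∀ c, gdAt l (fun _ => 0) x c) : x = stdp A := by
  have key : ∀ i k, i < k → x (k+1) i = x k i := by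
    intro i
    induction i using Nat.strong_induction_on with
    | _ i ih =>
    intro k hk
    by_contra hne
    have hlt : x k i < x (k+1) i := lt_of_le_of_ne (h.up k i) (Ne.symm hne)
    have hkl : k < l := by
      by_contra hkl
      rw [h.top k i (by omega), h.top (k+1) i (by omega)] at hlt
      omega
    set c := x (k+1) i - 1 with hc
    have mono : Monotone fun k => x k i := monotone_nat_of_le_succ fun k => h.up k i
    have g1 : gc l x c i = 0 := by
      rw [gc, Nat.sub_eq_zero_iff_le]
      apply Finset.sum_le_sum
      intro j _
      rcases lt_trichotomy j i with hj | hj | hj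
      · rw [ih j hj i hj]
      · subst hj
        have : x (j+1) j ≤ x k j := mono hk
        omega
      · rw [h.z (i+1) j hj]; omega
    have g2 : gG l x c k < gG l x c (k+1) := by
      apply Finset.sum_lt_sum
      · intro j _
        have := h.up k j
        omega
      · exact ⟨i, by simp; omega, by omega⟩
    have ch : ∀ m, i ≤ m → m < l → gc l x c m ≤ gc l x c i := by
      intro m him
      induction m, him using Nat.le_induction with
      | base => intro _; exact le_rfl
      | succ m hm ih2 =>
        intro hml
        have := hg c m hml
        have := ih2 (by omega)
        simp only [zero_add] at *
        omega
    have := ch k (by omega) hkl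
    rw [g1, gc] at this
    omega
  have key2 : ∀ i k m, i < k → x (k+m) i = x k i := by
    intro i k m hk
    induction m with
    | zero => rfl
    | succ m ih => rw [← ih, ← key i (k+m) (by omega)]; rfl
  funext k i
  simp only [stdp]
  split_ifs with hik
  · rw [← key2 i k l hik, h.top (k+l) i (by omega)]
  · exact h.z k i (by omega)

theorem alt_ne_zero_dl (l : ℕ) : alt l (dl l) ≠ 0 := by
  classical
  intro h0
  have h := coeff_mul_alt l 1 (dl l) (dl l)
  rw [h0, mul_zero, coeff_zero, Finset.sum_eq_single 1] at h
  · have e : fs (dl l - dl l ∘ (1 : Equiv.Perm (Fin l))) = 0 := by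
      ext i; simp [fs_apply]
    rw [e] at h
    simp at h
  · intro σ _ hσ
    rw [if_neg, mul_zero]
    intro hle
    apply hσ
    have hge : ∀ i, i ≤ σ i := by
      intro i
      have := hle i
      simp only [dl, Function.comp] at this
      rw [Fin.le_def]
      omega
    have hs : ∑ i : Fin l, ((σ i : Fin l) : ℕ) = ∑ i : Fin l, (i : ℕ) :=
      Equiv.sum_comp σ (fun i => (i : ℕ))
    have := (Finset.sum_eq_sum_iff_of_le (fun i _ => (Fin.le_def.1 (hge i)))).1 hs.symm
    ext i
    rw [← this i (Finset.mem_univ _)]; rfl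
  · simp

theorem schur_eq_gtp (l : ℕ) (A : Fin l → ℕ) (hA : Antitone A) : schur l A = gtp l (ex A) := by
  classical
  apply mul_right_cancel₀ (alt_ne_zero_dl l)
  rw [← vdm_eq_alt, schur_mul_vdm, vdm_eq_alt,
    gtp_mul_alt_good l (ex A) (fun _ => 0) (ex A 0) (ex_bd hA) (dl l) (by simp) (by simp)]
  have hs : (gts l (ex A)).filter (fun x => ∀ c', gdAt l (fun _ => 0) x c') = {stdp (ex A)} := by
    ext x
    simp only [Finset.mem_filter, mem_gts, Finset.mem_singleton]
    constructor
    · rintro ⟨h1, h2⟩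
      exact good_std h1 h2
    · rintro rfl
      refine ⟨stdp_gt (ex_anti hA) (ex_ge A), ?_⟩
      intro c k hk
      rw [gc_stdp l _ c k (by omega), gc_stdp l _ c (k+1) hk]
      have := ex_anti hA (Nat.le_succ k)
      simp only [Nat.succ_eq_add_one] at this
      simp only [zero_add]
      omega
  rw [hs, Finset.sum_singleton]
  congr 1
  funext i
  simp only [Pi.add_apply, wt]
  rw [gc_stdp l _ 0 i i.2, ex_coe]
  omega

/-- shift by the staircase. -/
def sh {l : ℕ} (C : Fin l → ℕ) : Fin l → ℕ := fun i => C i + dl l i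

theorem sh_strict {l : ℕ} {C : Fin l → ℕ} (hC : Antitone C) : StrictAnti (sh C) := by
  intro i j hij
  have := hC hij.le
  have := j.2
  rw [Fin.lt_def] at hij
  simp only [sh, dl]
  omega

theorem fs_inj {l : ℕ} {u v : Fin l → ℕ} (h : fs u = fs v) : u = v := by
  funext i
  rw [← fs_apply u, h, fs_apply]

theorem perm_eq_one_of_strict {l : ℕ} (σ : Equiv.Perm (Fin l)) (h : StrictMono σ) : σ = 1 := by
  have : (σ : Fin l → Fin l) = id := by
    apply (StrictMono.range_inj h strictMono_id).1
    rw [Set.range_id, σ.surjective.range_eq]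
  ext i
  rw [this]; rfl

theorem coeff_alt (l : ℕ) {b c : Fin l → ℕ} (hb : StrictAnti b) (hc : StrictAnti c) :
    coeff (fs b) (alt l c) = if b = c then 1 else 0 := by
  classical
  have key : ∀ σ : Equiv.Perm (Fin l), c ∘ σ = b → σ = 1 := by
    intro σ h
    apply perm_eq_one_of_strict
    intro i j hij
    have := hb hij
    rw [← h] at this
    exact hc.lt_iff_gt.1 this
  rw [alt_eq_sum, MvPolynomial.coeff_sum]
  have : ∀ σ : Equiv.Perm (Fin l), coeff (fs b) (((Equiv.Perm.sign σ : ℤ) : MvPolynomial (Fin l) ℤ) *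
      monomial (fs (c ∘ σ)) 1) = if c ∘ σ = b then (Equiv.Perm.sign σ : ℤ) else 0 := by
    intro σ
    rw [← eq_intCast (C : ℤ →+* MvPolynomial (Fin l) ℤ), coeff_C_mul, coeff_monomial]
    by_cases h : c ∘ σ = b
    · simp [h]
    · rw [if_neg h, if_neg, mul_zero]
      intro h2; exact h (fs_inj h2)
  simp only [this]
  rw [Finset.sum_eq_single 1]
  · simp [eq_comm]
  · intro σ _ hσ
    rw [if_neg]
    intro h; exact hσ (key σ h)
  · simp

/-- nonnegative combinations of Schur alternants. -/
noncomputable def Qs (l : ℕ) : AddSubmonoid (MvPolynomial (Fin l) ℤ) :=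
  AddSubmonoid.closure {f | ∃ C : Fin l → ℕ, Antitone C ∧ f = alt l (sh C)}

theorem anti_of_succ {l : ℕ} {α : Type*} [Preorder α] {v : Fin l → α}
    (h : ∀ k (hk : k + 1 < l), v ⟨k+1, hk⟩ ≤ v ⟨k, by omega⟩) : Antitone v := by
  have : ∀ n (i j : Fin l), (j : ℕ) = i + n → v j ≤ v i := by
    intro n
    induction n with
    | zero =>
      intro i j hij
      have : j = i := Fin.ext (by omega)
      rw [this]
    | succ n ih =>
      intro i j hij
      have h1 := ih i ⟨i + n, by omega⟩ rfl
      have h2 := h (i + n) (by omega)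
      have e : j = ⟨i + n + 1, by omega⟩ := Fin.ext (by simp; omega)
      rw [e]
      exact h2.trans h1
  intro i j hij
  rw [Fin.le_def] at hij
  exact this (j - i) i j (by omega)

theorem schur_mul_Qs (l : ℕ) {A : Fin l → ℕ} (hA : Antitone A) {f : MvPolynomial (Fin l) ℤ}
    (hf : f ∈ Qs l) : schur l A * f ∈ Qs l := by
  classical
  induction hf using AddSubmonoid.closure_induction with
  | mem f hf =>
    obtain ⟨C, hC, rfl⟩ := hf
    rw [schur_eq_gtp l A hA, gtp_mul_alt_good l (ex A) (ex C) (ex A 0) (ex_bd hA) (sh C)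
      (by intro k; rw [ex_coe]; rfl) (by intro k _; exact ex_anti hC (Nat.le_succ k))]
    refine AddSubmonoid.sum_mem _ fun x hx => AddSubmonoid.subset_closure ?_
    simp only [Finset.mem_filter, mem_gts] at hx
    refine ⟨fun i => C i + wt l x i, ?_, ?_⟩
    · apply anti_of_succ
      intro k hk
      have := hx.2 0 k hk
      simp only [ex, hk, dif_pos, show k < l by omega] at this
      exact this
    · congr 1
      funext i
      simp only [Pi.add_apply, sh]
      omega
  | zero => rw [mul_zero]; exact AddSubmonoid.zero_mem _
  | add x y _ _ hx hy => rw [mul_add]; exact AddSubmonoid.add_mem _ hx hy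

theorem Qs_coeff_nonneg (l : ℕ) {B : Fin l → ℕ} (hB : Antitone B) {f : MvPolynomial (Fin l) ℤ}
    (hf : f ∈ Qs l) : 0 ≤ coeff (fs (sh B)) f := by
  induction hf using AddSubmonoid.closure_induction with
  | mem f hf =>
    obtain ⟨C, hC, rfl⟩ := hf
    rw [coeff_alt l (sh_strict hB) (sh_strict hC)]
    split_ifs <;> simp
  | zero => simp
  | add x y _ _ hx hy => rw [coeff_add]; exact add_nonneg hx hy

theorem Qs_split (l : ℕ) {B : Fin l → ℕ} (hB : Antitone B) {f : MvPolynomial (Fin l) ℤ}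
    (hf : f ∈ Qs l) (hpos : 0 < coeff (fs (sh B)) f) : ∃ f' ∈ Qs l, f = alt l (sh B) + f' := by
  induction hf using AddSubmonoid.closure_induction with
  | mem f hf =>
    obtain ⟨C, hC, rfl⟩ := hf
    rw [coeff_alt l (sh_strict hB) (sh_strict hC)] at hpos
    split_ifs at hpos with h
    · exact ⟨0, AddSubmonoid.zero_mem _, by rw [h, add_zero]⟩
    · simp at hpos
  | zero => simp at hpos
  | add x y h1 h2 hx hy =>
    rw [coeff_add] at hpos
    by_cases h : 0 < coeff (fs (sh B)) x
    · obtain ⟨f', hf', e⟩ := hx h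
      exact ⟨f' + y, AddSubmonoid.add_mem _ hf' h2, by rw [e, add_assoc]⟩
    · obtain ⟨f', hf', e⟩ := hy (by omega)
      exact ⟨x + f', AddSubmonoid.add_mem _ h1 hf', by rw [e]; ring⟩

theorem pow_mem_Qs (l : ℕ) {A : Fin l → ℕ} (hA : Antitone A) (n : ℕ) :
    schur l A ^ n * vdm l ∈ Qs l := by
  induction n with
  | zero =>
    rw [pow_zero, one_mul, vdm_eq_alt]
    refine AddSubmonoid.subset_closure ⟨fun _ => 0, fun _ _ _ => le_rfl, ?_⟩
    congr 1
    funext i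
    simp [sh]
  | succ n ih =>
    rw [pow_succ', mul_assoc]
    exact schur_mul_Qs l hA ih

/-- positivity of the multiplicity of `B` in the `n`-th power. -/
def Pos {l : ℕ} (A : Fin l → ℕ) (n : ℕ) (B : Fin l → ℕ) : Prop :=
  0 < schurMult l B (schur l A ^ n)

theorem Pos_iff {l : ℕ} (A : Fin l → ℕ) (n : ℕ) (B : Fin l → ℕ) :
    Pos A n B ↔ 0 < coeff (fs (sh B)) (schur l A ^ n * vdm l) := Iff.rfl

theorem Pos_zero {l : ℕ} (A : Fin l → ℕ) : Pos A 0 (fun _ => 0) := by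
  rw [Pos_iff, pow_zero, one_mul, vdm_eq_alt]
  have e : sh (fun _ => 0 : Fin l → ℕ) = dl l := by funext i; simp [sh]
  have h : StrictAnti (dl l) := by
    rw [← e]; exact sh_strict fun _ _ _ => le_rfl
  rw [e, coeff_alt l h h]
  simp

theorem Pos_step {l : ℕ} {A : Fin l → ℕ} (hA : Antitone A) {n : ℕ} {B C : Fin l → ℕ}
    (hB : Antitone B) (hC : Antitone C) (hp : Pos A n C)
    (h : 0 < coeff (fs (sh B)) (schur l A * alt l (sh C))) : Pos A (n+1) B := by
  rw [Pos_iff] at *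
  obtain ⟨f', hf', e⟩ := Qs_split l hC (pow_mem_Qs l hA n) hp
  rw [pow_succ', mul_assoc, e, mul_add, coeff_add]
  have := Qs_coeff_nonneg l hB (schur_mul_Qs l hA hf')
  omega

/-! weights -/

theorem coeff_schur (l : ℕ) {A : Fin l → ℕ} (hA : Antitone A) (ν : Fin l → ℕ) :
    coeff (fs ν) (schur l A) = (((gts l (ex A)).filter fun x => wt l x = ν).card : ℤ) := by
  classical
  rw [schur_eq_gtp l A hA, gtp, coeff_sum, Finset.card_filter]
  push_cast
  refine Finset.sum_congr rfl fun x _ => ?_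
  rw [coeff_monomial]
  by_cases h : wt l x = ν
  · simp [h]
  · rw [if_neg h, if_neg]
    intro h2; exact h (fs_inj h2)

theorem coeff_schur_perm (l : ℕ) {A : Fin l → ℕ} (hA : Antitone A) (ν : Fin l → ℕ)
    (σ : Equiv.Perm (Fin l)) : coeff (fs (ν ∘ σ)) (schur l A) = coeff (fs ν) (schur l A) := by
  have h := coeff_rename_mapDomain (σ⁻¹ : Equiv.Perm (Fin l)) (Equiv.injective _) (schur l A) (fs ν)
  rw [schur_eq_gtp l A hA, gtp_symm l (ex A) _ (ex_bd hA), ← schur_eq_gtp l A hA] at h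
  rw [← h]
  congr 1
  ext i
  obtain ⟨j, rfl⟩ := (σ⁻¹).surjective i
  rw [Finsupp.mapDomain_apply (Equiv.injective _), fs_apply, fs_apply]
  simp

theorem coeff_schur_pos (l : ℕ) {A : Fin l → ℕ} (hA : Antitone A) {ν : Fin l → ℕ}
    {x : ℕ → ℕ → ℕ} (hx : IsGT l (ex A) x) (hw : wt l x = ν) : 0 < coeff (fs ν) (schur l A) := by
  rw [coeff_schur l hA]
  exact_mod_cast Finset.card_pos.2 ⟨x, by simp [mem_gts, hx, hw]⟩

theorem coeff_schur_self (l : ℕ) {A : Fin l → ℕ} (hA : Antitone A) :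
    0 < coeff (fs A) (schur l A) := by
  apply coeff_schur_pos l hA (stdp_gt (ex_anti hA) (ex_ge A))
  funext i
  simp only [wt]
  rw [gc_stdp l _ 0 i i.2, ex_coe]
  omega

/-- partial sums. -/
def ps {l : ℕ} {α : Type*} [AddCommMonoid α] (v : Fin l → α) (r : ℕ) : α :=
  ∑ i ∈ Finset.univ.filter (fun i : Fin l => (i : ℕ) < r), v i

theorem ps_zero {l : ℕ} {α : Type*} [AddCommMonoid α] (v : Fin l → α) : ps v 0 = 0 := by
  simp [ps]

theorem ps_succ {l : ℕ} {α : Type*} [AddCommMonoid α] (v : Fin l → α) (r : ℕ) (hr : r < l) :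
    ps v (r+1) = ps v r + v ⟨r, hr⟩ := by
  have : Finset.univ.filter (fun i : Fin l => (i : ℕ) < r + 1) =
      insert ⟨r, hr⟩ (Finset.univ.filter (fun i : Fin l => (i : ℕ) < r)) := by
    ext i
    simp only [mem_filter, mem_univ, true_and, mem_insert, Fin.ext_iff]
    omega
  rw [ps, this, Finset.sum_insert (by simp), add_comm, ps]

theorem ps_total {l : ℕ} {α : Type*} [AddCommMonoid α] (v : Fin l → α) (r : ℕ) (hr : l ≤ r) :
    ps v r = ∑ i, v i := by
  rw [ps, Finset.filter_true_of_mem]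
  intro i _
  exact i.2.trans_le hr

theorem ps_wt {l : ℕ} {A : ℕ → ℕ} {x : ℕ → ℕ → ℕ} (h : IsGT l A x) (r : ℕ) (hr : r ≤ l) :
    ps (wt l x) r = ∑ i ∈ range l, x r i := by
  induction r with
  | zero =>
    rw [ps_zero]
    symm
    apply Finset.sum_eq_zero
    intro i _; exact h.z 0 i (by omega)
  | succ r ih =>
    rw [ps_succ _ r (by omega), ih (by omega)]
    have := h.gG_mono 0 r
    simp only [wt, gc]
    simp only [gG, Nat.sub_zero] at *
    omega

theorem ps_ex {l : ℕ} (A : Fin l → ℕ) (r : ℕ) (hr : r ≤ l) : ps A r = ∑ i ∈ range r, ex A i := by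
  induction r with
  | zero => simp [ps_zero]
  | succ r ih => rw [ps_succ _ r (by omega), ih (by omega), sum_range_succ, ← ex_coe A ⟨r, _⟩]

theorem coeff_ne_zero_dom (l : ℕ) {A : Fin l → ℕ} (hA : Antitone A) {ν : Fin l → ℕ}
    (h : coeff (fs ν) (schur l A) ≠ 0) :
    (∀ r, ps ν r ≤ ps A r) ∧ ∑ i, ν i = ∑ i, A i := by
  rw [coeff_schur l hA] at h
  have h2 : 0 < ((gts l (ex A)).filter fun x => wt l x = ν).card := by
    rcases Nat.eq_zero_or_pos ((gts l (ex A)).filter fun x => wt l x = ν).card with h1 | h1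
    · rw [h1] at h; simp at h
    · exact h1
  obtain ⟨x, hx⟩ := Finset.card_pos.1 h2
  simp only [mem_filter, mem_gts] at hx
  obtain ⟨hx, rfl⟩ := hx
  have htot : ∑ i, wt l x i = ∑ i, A i := by
    rw [← ps_total (wt l x) l le_rfl, ← ps_total A l le_rfl, ps_wt hx l le_rfl, ps_ex A l le_rfl]
    exact Finset.sum_congr rfl fun i _ => hx.top l i le_rfl
  refine ⟨fun r => ?_, htot⟩
  rcases le_total l r with hr | hr
  · rw [ps_total _ r hr, ps_total _ r hr, htot]
  · rw [ps_wt hx r hr, ps_ex A r hr]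
    have : ∑ i ∈ range l, x r i = ∑ i ∈ range r, x r i := by
      symm
      apply Finset.sum_subset
      · intro i; simp only [mem_range]; omega
      · intro i _ hi
        simp only [mem_range] at hi
        exact hx.z r i (by omega)
    rw [this]
    exact Finset.sum_le_sum fun i _ => hx.le_A r i

theorem brauer {l : ℕ} {A : Fin l → ℕ} (hA : Antitone A) {n : ℕ} {B C : Fin l → ℕ}
    (hB : Antitone B) (hC : Antitone C) (hp : Pos A n C) (ν₀ : Fin l → ℕ)
    (e : ∀ i, B i = C i + ν₀ i) (h0 : 0 < coeff (fs ν₀) (schur l A))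
    (h1 : ∀ σ : Equiv.Perm (Fin l), ∀ ν : Fin l → ℕ, (∀ i, ν i + sh C (σ i) = sh B i) →
      coeff (fs ν) (schur l A) ≠ 0 → σ = 1) : Pos A (n+1) B := by
  classical
  apply Pos_step hA hB hC hp
  rw [coeff_mul_alt, Finset.sum_eq_single 1]
  · rw [if_pos]
    · have : sh B - sh C ∘ (1 : Equiv.Perm (Fin l)) = ν₀ := by
        funext i
        have := e i
        simp only [Pi.sub_apply, Function.comp, Equiv.Perm.one_apply, sh]
        omega
      rw [this]
      simpa using h0
    · intro i
      have := e i
      simp only [Function.comp, Equiv.Perm.one_apply, sh]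
      omega
  · intro σ _ hσ
    by_cases hle : sh C ∘ σ ≤ sh B
    · rw [if_pos hle]
      by_contra hne
      apply hσ
      apply h1 σ (sh B - sh C ∘ σ)
      · intro i
        have := hle i
        simp only [Function.comp, Pi.sub_apply] at *
        omega
      · intro h; apply hne; rw [h, mul_zero]
    · rw [if_neg hle, mul_zero]
  · simp

theorem abel (f g : ℕ → ℤ) (n : ℕ) (hf : ∀ i, i < n → f (i+1) ≤ f i)
    (hg : ∀ r, r ≤ n + 1 → 0 ≤ ∑ i ∈ range r, g i) :
    f n * ∑ i ∈ range (n+1), g i ≤ ∑ i ∈ range (n+1), f i * g i := by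
  induction n with
  | zero => simp
  | succ n ih =>
    have h1 := ih (fun i hi => hf i (by omega)) (fun r hr => hg r (by omega))
    rw [sum_range_succ (fun i => f i * g i) (n+1), sum_range_succ g (n+1), mul_add]
    have h2 := hf n (by omega)
    have h3 := hg (n+1) (by omega)
    nlinarith [mul_le_mul_of_nonneg_right h2 h3]

theorem norm_le {l : ℕ} {A : Fin l → ℕ} {ν : Fin l → ℕ} (hν : Antitone ν)
    (h : ∀ r, ps ν r ≤ ps A r) (ht : ∑ i, ν i = ∑ i, A i) :
    ∑ i, (ν i : ℤ) * ν i ≤ ∑ i, (A i : ℤ) * A i := by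
  have h1 : 0 ≤ ∑ i, (ν i : ℤ) * ((A i : ℤ) - ν i) := by
    rcases Nat.eq_zero_or_pos l with h0 | h0
    · subst h0; simp
    · obtain ⟨m, rfl⟩ : ∃ m, l = m + 1 := ⟨l - 1, by omega⟩
      have hps : ∀ r, r ≤ m + 1 → ∑ i ∈ range r, ((ex A i : ℤ) - ex ν i) = ((ps A r : ℕ) : ℤ) - (ps ν r : ℕ) := by
        intro r hr
        rw [ps_ex A r hr, ps_ex ν r hr, Finset.sum_sub_distrib]
        push_cast; rfl
      have := abel (fun i => (ex ν i : ℤ)) (fun i => (ex A i : ℤ) - ex ν i) m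
        (fun i _ => by exact_mod_cast ex_anti hν (Nat.le_succ i))
        (fun r hr => by rw [hps r hr]; have := h r; omega)
      rw [hps (m+1) le_rfl, ps_total A _ le_rfl, ps_total ν _ le_rfl, ht, sub_self, mul_zero,
        Finset.sum_range] at this
      simpa [ex_coe] using this
  have h2 : 0 ≤ ∑ i, ((A i : ℤ) - ν i) * ((A i : ℤ) - ν i) :=
    Finset.sum_nonneg fun i _ => mul_self_nonneg _
  have h3 : ∑ i, (A i : ℤ) * A i = ∑ i, (ν i : ℤ) * ν i + 2 * (∑ i, (ν i : ℤ) * ((A i : ℤ) - ν i))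
      + ∑ i, ((A i : ℤ) - ν i) * ((A i : ℤ) - ν i) := by
    rw [Finset.mul_sum, ← Finset.sum_add_distrib, ← Finset.sum_add_distrib]
    exact Finset.sum_congr rfl fun i _ => by ring
  omega

theorem coeff_norm_le {l : ℕ} {A : Fin l → ℕ} (hA : Antitone A) {ν : Fin l → ℕ}
    (h : coeff (fs ν) (schur l A) ≠ 0) : ∑ i, (ν i : ℤ) * ν i ≤ ∑ i, (A i : ℤ) * A i := by
  let τ : Equiv.Perm (Fin l) := Tuple.sort (fun i => OrderDual.toDual (ν i))
  have hτ : Antitone (ν ∘ τ) := by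
    have := Tuple.monotone_sort (fun i => OrderDual.toDual (ν i))
    intro i j hij
    exact this hij
  rw [← coeff_schur_perm l hA ν τ] at h
  have hd := coeff_ne_zero_dom l hA h
  have := norm_le hτ hd.1 hd.2
  rw [← Equiv.sum_comp τ]
  exact this

theorem F1 {l : ℕ} {A : Fin l → ℕ} (hA : Antitone A) {n : ℕ} {B C : Fin l → ℕ}
    (hB : Antitone B) (hC : Antitone C) (hp : Pos A n C) (w : Equiv.Perm (Fin l))
    (e : ∀ i, B i = C i + A (w i)) : Pos A (n+1) B := by
  apply brauer hA hB hC hp (A ∘ w) e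
  · rw [coeff_schur_perm l hA]; exact coeff_schur_self l hA
  intro σ ν hν hne
  have hn := coeff_norm_le hA hne
  have hb := sh_strict hB
  have hc := sh_strict hC
  have mv : Monovary (fun i => (sh B i : ℤ)) (fun i => (sh C i : ℤ)) := by
    intro i j hij
    show (sh B i : ℤ) ≤ sh B j
    have hij : (sh C i : ℤ) < sh C j := hij
    have : sh C i < sh C j := by exact_mod_cast hij
    have := hc.lt_iff_gt.1 this
    exact_mod_cast (hb this).le
  have e1 : ∑ i, (ν i : ℤ) * ν i = ∑ i, (sh B i : ℤ) * sh B i - 2 * ∑ i, (sh B i : ℤ) * sh C (σ i)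
      + ∑ i, (sh C i : ℤ) * sh C i := by
    rw [← Equiv.sum_comp σ (fun i => (sh C i : ℤ) * sh C i), Finset.mul_sum, ← Finset.sum_sub_distrib,
      ← Finset.sum_add_distrib]
    refine Finset.sum_congr rfl fun i _ => ?_
    rw [← hν i]; push_cast; ring
  have e2 : ∑ i, (A i : ℤ) * A i = ∑ i, (sh B i : ℤ) * sh B i - 2 * ∑ i, (sh B i : ℤ) * sh C i
      + ∑ i, (sh C i : ℤ) * sh C i := by
    rw [← Equiv.sum_comp w (fun i => (A i : ℤ) * A i), Finset.mul_sum, ← Finset.sum_sub_distrib,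
      ← Finset.sum_add_distrib]
    refine Finset.sum_congr rfl fun i _ => ?_
    have : (sh B i : ℤ) = sh C i + A (w i) := by
      have := e i
      simp only [sh]; push_cast; omega
    rw [this]; ring
  have hge : ∑ i, (sh B i : ℤ) * sh C i ≤ ∑ i, (sh B i : ℤ) * sh C (σ i) := by omega
  have hnot := mt (Monovary.sum_mul_comp_perm_lt_sum_mul_iff (σ := σ) mv).2 (not_lt.2 hge)
  rw [not_not] at hnot
  apply perm_eq_one_of_strict
  intro i j hij
  by_contra hcon
  rw [not_lt] at hcon
  have hlt : σ j < σ i := lt_of_le_of_ne hcon (fun h => hij.ne' (σ.injective h))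
  have := hnot (i := i) (j := j) (by simpa using hc hlt)
  have h2 := hb hij
  simp only at this
  omega

theorem pfx_iff {l : ℕ} {σ : Equiv.Perm (Fin l)} {r : ℕ}
    (h : ∀ i : Fin l, (i : ℕ) < r → (σ i : ℕ) < r) (i : Fin l) : (σ i : ℕ) < r ↔ (i : ℕ) < r := by
  have hs : (Finset.univ.filter (fun i : Fin l => (i : ℕ) < r)).map σ.toEmbedding =
      Finset.univ.filter (fun i : Fin l => (i : ℕ) < r) := by
    apply Finset.eq_of_subset_of_card_le
    · intro k hk
      simp only [mem_map, mem_filter, mem_univ, true_and] at *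
      obtain ⟨a, ha, rfl⟩ := hk
      exact h a ha
    · simp
  refine ⟨fun hi => ?_, h i⟩
  have : σ i ∈ Finset.univ.filter (fun i : Fin l => (i : ℕ) < r) := by simpa using hi
  rw [← hs] at this
  simp only [mem_map, mem_filter, mem_univ, true_and] at this
  obtain ⟨a, ha, hk⟩ := this
  have : a = i := σ.injective hk
  rw [← this]; exact ha

theorem ps_perm {l : ℕ} {α : Type*} [AddCommMonoid α] (v : Fin l → α) {σ : Equiv.Perm (Fin l)} {r : ℕ}
    (h : ∀ i : Fin l, (i : ℕ) < r → (σ i : ℕ) < r) : ps (v ∘ σ) r = ps v r := by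
  apply Finset.sum_equiv σ
  · intro i; simp [pfx_iff h i]
  · intro i _; rfl

theorem ps_add {l : ℕ} {α : Type*} [AddCommMonoid α] (v w : Fin l → α) (r : ℕ) :
    ps (fun i => v i + w i) r = ps v r + ps w r := Finset.sum_add_distrib

theorem ps_ind {l : ℕ} (p : Fin l) (r : ℕ) :
    ps (fun i : Fin l => if i = p then 1 else 0) r = if (p : ℕ) < r then 1 else 0 := by
  rw [ps, Finset.sum_ite_eq']
  simp

theorem pfx_of_ps {l : ℕ} {c : Fin l → ℕ} (hc : Antitone c) {σ : Equiv.Perm (Fin l)} {r g : ℕ}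
    (hg : ∀ i k : Fin l, (i : ℕ) < r → r ≤ (k : ℕ) → c k + g ≤ c i)
    (h : ps c r < ps (c ∘ σ) r + g) (i : Fin l) (hi : (i : ℕ) < r) : (σ i : ℕ) < r := by
  classical
  by_contra hbad
  rw [not_lt] at hbad
  have hr : r < l := lt_of_le_of_lt hbad (σ i).2
  have hr0 : r - 1 < l := by omega
  set t : ℤ := ((c ⟨r - 1, hr0⟩ : ℕ) : ℤ) with ht
  let φ : Fin l → ℤ := fun k => if (k : ℕ) < r then (c k : ℤ) - t else 0
  have hφ : ∀ k, 0 ≤ φ k := by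
    intro k
    simp only [φ]
    split_ifs with hk
    · have : c ⟨r - 1, hr0⟩ ≤ c k := hc (by rw [Fin.le_def]; simp; omega)
      omega
    · exact le_rfl
  set S := Finset.univ.filter (fun i : Fin l => (i : ℕ) < r) with hS
  have hiS : i ∈ S := by simp [hS, hi]
  have h1 : ∑ k ∈ S, ((c (σ k) : ℤ) - t) + g ≤ ∑ k ∈ S, φ (σ k) := by
    rw [← Finset.add_sum_erase _ _ hiS, ← Finset.add_sum_erase S (fun k => φ (σ k)) hiS]
    have ha : ((c (σ i) : ℤ) - t) + g ≤ φ (σ i) := by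
      have := hg ⟨r - 1, hr0⟩ (σ i) (by simp; omega) hbad
      simp only [φ, if_neg (not_lt.2 hbad)]
      omega
    have hb : ∑ k ∈ S.erase i, ((c (σ k) : ℤ) - t) ≤ ∑ k ∈ S.erase i, φ (σ k) := by
      apply Finset.sum_le_sum
      intro k _
      simp only [φ]
      split_ifs with hk
      · exact le_rfl
      · have := hg ⟨r - 1, hr0⟩ (σ k) (by simp; omega) (by omega)
        omega
    omega
  have h2 : ∑ k ∈ S, φ (σ k) ≤ ∑ k, φ (σ k) :=
    Finset.sum_le_sum_of_subset_of_nonneg (Finset.subset_univ _) fun k _ _ => hφ _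
  rw [Equiv.sum_comp σ φ] at h2
  have h3 : ∑ k, φ k = ∑ k ∈ S, ((c k : ℤ) - t) := by
    rw [hS, Finset.sum_filter]
  rw [h3] at h2
  rw [Finset.sum_sub_distrib] at h1 h2
  have e1 : ((ps c r : ℕ) : ℤ) = ∑ k ∈ S, (c k : ℤ) := by rw [ps]; push_cast; rfl
  have e2 : ((ps (c ∘ σ) r : ℕ) : ℤ) = ∑ k ∈ S, (c (σ k) : ℤ) := by rw [ps]; push_cast; rfl
  omega

/-- pattern for one raising step. -/
def stdq (A : ℕ → ℕ) (j k i : ℕ) : ℕ :=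
  if k = j ∧ i + 1 = j then A i - 1 else if i < k then A i else 0

theorem stdq_gt {l : ℕ} {A : ℕ → ℕ} (hA : Antitone A) (h0 : ∀ i, l ≤ i → A i = 0) (j : ℕ)
    (hj : j < l) (hgap : ∀ i, i + 1 = j → A j < A i) : IsGT l A (stdq A j) where
  z k i h := by
    simp only [stdq]
    rw [if_neg (by omega), if_neg (by omega)]
  up k i := by
    simp only [stdq]
    split_ifs <;> omega
  dn k i := by
    have h1 := hA (Nat.le_succ i)
    simp only [Nat.succ_eq_add_one] at h1
    simp only [stdq]
    by_cases h : k = j ∧ i + 1 = j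
    · have h3 := hgap i h.2
      have : A (i+1) = A j := by rw [h.2]
      rw [if_pos h]
      split_ifs <;> omega
    · rw [if_neg h]
      split_ifs <;> omega
  top k i h := by
    simp only [stdq]
    split_ifs with h1 h2
    · omega
    · rfl
    · rw [h0 i (by omega)]

theorem gG_stdq (l : ℕ) (A : ℕ → ℕ) (j : ℕ) (hj0 : 0 < j) (hj : j < l) (hpos : 0 < A (j-1)) (k : ℕ) :
    gG l (stdq A j) 0 k + (if k = j then 1 else 0) = gG l (stdp A) 0 k := by
  simp only [gG, Nat.sub_zero]
  by_cases hk : k = j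
  · subst hk
    rw [if_pos rfl]
    have : ∀ i ∈ range l, stdp A k i = stdq A k k i + if i = k - 1 then 1 else 0 := by
      intro i _
      simp only [stdp, stdq]
      by_cases h : i = k - 1
      · subst h
        rw [if_pos (show k - 1 < k by omega), if_pos (show True ∧ k - 1 + 1 = k from ⟨trivial, by omega⟩), if_pos rfl]
        omega
      · rw [if_neg (show ¬ (True ∧ i + 1 = k) by omega), if_neg h]
        rfl
    rw [Finset.sum_congr rfl this, Finset.sum_add_distrib]
    simp
    omega
  · rw [if_neg hk, add_zero]
    refine Finset.sum_congr rfl fun i _ => ?_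
    simp only [stdp, stdq]
    rw [if_neg (by omega)]

theorem coeff_raise {l : ℕ} {A : Fin l → ℕ} (hA : Antitone A) (p q : Fin l) (j : ℕ)
    (hpj : (p : ℕ) < j) (hjq : j ≤ (q : ℕ))
    (hAp : ∀ i : Fin l, p ≤ i → (i : ℕ) < j → A i = A p)
    (hAq : ∀ i : Fin l, j ≤ (i : ℕ) → i ≤ q → A i = A q) (hlt : A q < A p) (ν : Fin l → ℕ)
    (hν : ∀ i, ν i + (if i = p then 1 else 0) = A i + (if i = q then 1 else 0)) :
    0 < coeff (fs ν) (schur l A) := by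
  have hjl : j < l := lt_of_le_of_lt hjq q.2
  let p' : Fin l := ⟨j - 1, by omega⟩
  let q' : Fin l := ⟨j, hjl⟩
  have ep : A p' = A p := hAp p' (by rw [Fin.le_def]; simp [p']; omega) (by simp [p']; omega)
  have eq : A q' = A q := hAq q' le_rfl (by rw [Fin.le_def]; exact hjq)
  have exp' : ex A (j-1) = A p := by rw [← ep, ← ex_coe A p']
  have exq' : ex A j = A q := by rw [← eq, ← ex_coe A q']
  have hgt := stdq_gt (ex_anti hA) (ex_ge A) j hjl
    (by intro i hi
        have : i = j - 1 := by omega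
        subst this; omega)
  let μ : Fin l → ℕ := wt l (stdq (ex A) j)
  have hμ : ∀ i, μ i + (if i = p' then 1 else 0) = A i + (if i = q' then 1 else 0) := by
    intro i
    have g1 := gG_stdq l (ex A) j (by omega) hjl (by omega) i
    have g2 := gG_stdq l (ex A) j (by omega) hjl (by omega) (i+1)
    have g3 := gG_stdp l (ex A) 0 i i.2
    have g4 := hgt.gG_mono 0 i
    have g5 := ex_coe A i
    simp only [μ, wt, gc, p', q', Fin.ext_iff]
    by_cases h1 : (i : ℕ) = j
    · rw [if_pos h1] at *
      rw [if_neg (by omega)] at *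
      omega
    · rw [if_neg h1] at *
      by_cases h2 : (i : ℕ) + 1 = j
      · rw [if_pos h2] at g2
        rw [if_pos (by omega)]
        omega
      · rw [if_neg h2] at g2
        rw [if_neg (by omega)]
        omega
  have hpos : 0 < coeff (fs μ) (schur l A) := coeff_schur_pos l hA hgt rfl
  have hpq : p ≠ q := by intro h; rw [h] at hpj; omega
  have hpq' : p' ≠ q' := by intro h; simp [p', q', Fin.ext_iff] at h; omega
  have h1 : p ≠ q' := by intro h; simp [q', Fin.ext_iff] at h; omega
  have h2 : p' ≠ q := by intro h; simp [p', Fin.ext_iff] at h; omega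
  have hfin : ν = μ ∘ (Equiv.swap p p' * Equiv.swap q q' : Equiv.Perm (Fin l)) := by
    funext i
    have a := hν i
    simp only [Function.comp, Equiv.Perm.mul_apply]
    by_cases i1 : i = p
    · subst i1
      rw [Equiv.swap_apply_of_ne_of_ne hpq h1, Equiv.swap_apply_left]
      have b := hμ p'
      simp [hpq, hpq'] at a b
      omega
    · by_cases i2 : i = q
      · subst i2
        rw [Equiv.swap_apply_left, Equiv.swap_apply_of_ne_of_ne h1.symm hpq'.symm]
        have b := hμ q'
        simp [hpq.symm, hpq'.symm] at a b
        omega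
      · rw [if_neg i1, if_neg i2] at a
        by_cases i3 : i = q'
        · subst i3
          rw [Equiv.swap_apply_right, Equiv.swap_apply_of_ne_of_ne hpq.symm h2.symm]
          have b := hμ q
          rw [if_neg h2.symm, if_neg (Ne.symm i2)] at b
          omega
        · rw [Equiv.swap_apply_of_ne_of_ne i2 i3]
          by_cases i4 : i = p'
          · subst i4
            rw [Equiv.swap_apply_right]
            have b := hμ p
            rw [if_neg (Ne.symm i1), if_neg h1] at b
            omega
          · rw [Equiv.swap_apply_of_ne_of_ne i1 i4]
            have b := hμ i
            rw [if_neg i4, if_neg i3] at b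
            omega
  rw [hfin, coeff_schur_perm l hA]
  exact hpos

theorem perm_one_of_ge {l : ℕ} (σ : Equiv.Perm (Fin l)) (h : ∀ i, i ≤ σ i) : σ = 1 := by
  have hs : ∑ i : Fin l, ((σ i : Fin l) : ℕ) = ∑ i : Fin l, (i : ℕ) :=
    Equiv.sum_comp σ (fun i => (i : ℕ))
  have := (Finset.sum_eq_sum_iff_of_le (fun i _ => (Fin.le_def.1 (h i)))).1 hs.symm
  ext i
  rw [← this i (Finset.mem_univ _)]; rfl

theorem F2 {l : ℕ} {A : Fin l → ℕ} (hA : Antitone A) {n : ℕ} {B C : Fin l → ℕ}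
    (hB : Antitone B) (hC : Antitone C) (hp : Pos A n C) (p q : Fin l) (j : ℕ)
    (hpj : (p : ℕ) < j) (hjq : j ≤ (q : ℕ))
    (hAp : ∀ i : Fin l, p ≤ i → (i : ℕ) < j → A i = A p)
    (hAq : ∀ i : Fin l, j ≤ (i : ℕ) → i ≤ q → A i = A q) (hlt : A q < A p)
    (hCj : ∀ i k : Fin l, (i : ℕ) < j → j ≤ (k : ℕ) → C k < C i)
    (e : ∀ i, B i + (if i = p then 1 else 0) = C i + A i + (if i = q then 1 else 0)) :
    Pos A (n+1) B := by
  have hpq : p ≠ q := by intro h; rw [h] at hpj; omega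
  let ν₀ : Fin l → ℕ := fun i => A i + (if i = q then 1 else 0) - (if i = p then 1 else 0)
  have hν₀ : ∀ i, ν₀ i + (if i = p then 1 else 0) = A i + (if i = q then 1 else 0) := by
    intro i
    simp only [ν₀]
    by_cases h : i = p
    · subst h; rw [if_pos rfl]; omega
    · rw [if_neg h]; omega
  apply brauer hA hB hC hp ν₀
  · intro i
    have := e i
    have := hν₀ i
    omega
  · exact coeff_raise hA p q j hpj hjq hAp hAq hlt ν₀ hν₀
  intro σ ν hν hne
  have hc := sh_strict hC
  have dom := coeff_ne_zero_dom l hA hne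
  have domS : ∀ τ : Equiv.Perm (Fin l), ∀ r, ps (ν ∘ τ) r ≤ ps A r := by
    intro τ
    rw [← coeff_schur_perm l hA ν τ] at hne
    exact (coeff_ne_zero_dom l hA hne).1
  have eb : ∀ i, sh B i + (if i = p then 1 else 0) = sh C i + A i + (if i = q then 1 else 0) := by
    intro i
    have := e i
    simp only [sh]
    omega
  -- the master identity on partial sums
  have master : ∀ r, ps ν r + ps (sh C ∘ σ) r + (if (p : ℕ) < r then 1 else 0) =
      ps (sh C) r + ps A r + (if (q : ℕ) < r then 1 else 0) := by
    intro r
    rw [← ps_ind p r, ← ps_ind q r, ← ps_add, ← ps_add, ← ps_add, ← ps_add]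
    congr 1
    funext i
    have := hν i
    have := eb i
    simp only [Function.comp]
    omega
  have pre1 : ∀ r, r ≤ (p : ℕ) → ∀ i : Fin l, (i : ℕ) < r → (σ i : ℕ) < r := by
    intro r hr
    apply pfx_of_ps hc.antitone (g := 1)
    · intro i k hi hk
      exact hc (show i < k by rw [Fin.lt_def]; omega)
    · have h1 := master r
      have h2 := dom.1 r
      rw [if_neg (by omega), if_neg (by omega)] at h1
      omega
  have pre2 : ∀ r, (q : ℕ) < r → ∀ i : Fin l, (i : ℕ) < r → (σ i : ℕ) < r := by
    intro r hr
    apply pfx_of_ps hc.antitone (g := 1)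
    · intro i k hi hk
      exact hc (show i < k by rw [Fin.lt_def]; omega)
    · have h1 := master r
      have h2 := dom.1 r
      rw [if_pos (by omega), if_pos (by omega)] at h1
      omega
  have pre3 : ∀ i : Fin l, (i : ℕ) < j → (σ i : ℕ) < j := by
    apply pfx_of_ps hc.antitone (g := 2)
    · intro i k hi hk
      have := hCj i k hi hk
      have := k.2
      simp only [sh, dl]
      omega
    · have h1 := master j
      have h2 := dom.1 j
      rw [if_pos (by omega), if_neg (by omega)] at h1
      omega
  -- bounds on ν
  have bd1 : ∀ x : Fin l, p ≤ x → ν x ≤ A p := by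
    intro x hx
    have h1 := domS (Equiv.swap p x) (p + 1)
    rw [ps_succ _ _ p.2, ps_succ _ _ p.2] at h1
    have h2 : ps (ν ∘ Equiv.swap p x) p = ps ν p := by
      apply Finset.sum_congr rfl
      intro i hi
      simp only [mem_filter, mem_univ, true_and] at hi
      rw [Fin.le_def] at hx
      simp only [Function.comp]
      rw [Equiv.swap_apply_of_ne_of_ne]
      · intro h; rw [h] at hi; omega
      · intro h; rw [h] at hi; omega
    have h3 := master p
    rw [ps_perm (sh C) (pre1 p le_rfl), if_neg (by omega), if_neg (by omega)] at h3
    have h4 : (ν ∘ Equiv.swap p x) ⟨p, p.2⟩ = ν x := by simp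
    rw [h4] at h1
    simp only [Fin.eta] at h1
    omega
  have bd2 : ∀ x : Fin l, x ≤ q → A q ≤ ν x := by
    intro x hx
    have h1 := domS (Equiv.swap q x) q
    have h2 : ps (ν ∘ Equiv.swap q x) (q + 1) = ps ν (q + 1) := by
      apply ps_perm
      intro i hi
      rw [Fin.le_def] at hx
      by_cases h : i = q
      · rw [h, Equiv.swap_apply_left]; omega
      · by_cases h' : i = x
        · rw [h', Equiv.swap_apply_right]; omega
        · rw [Equiv.swap_apply_of_ne_of_ne h h']; exact hi
    have h3 := master (q + 1)
    rw [ps_perm (sh C) (pre2 (q+1) (by omega)), if_pos (by omega), if_pos (by omega)] at h3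
    have h4 := ps_succ A q q.2
    rw [ps_succ _ _ q.2] at h2
    have h5 : (ν ∘ Equiv.swap q x) ⟨q, q.2⟩ = ν x := by simp
    rw [h5] at h2
    simp only [Fin.eta] at h4
    omega
  -- lower half
  have low : ∀ m (x : Fin l), (x : ℕ) = m → m < j → σ x = x := by
    intro m
    induction m using Nat.strong_induction_on with
    | _ m ih =>
    intro x hx hm
    have hge : x ≤ σ x := by
      by_contra hcon
      rw [not_le] at hcon
      have := ih (σ x) (by rw [Fin.lt_def] at hcon; omega) (σ x) rfl (by rw [Fin.lt_def] at hcon; omega)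
      have := σ.injective this
      rw [this] at hcon
      exact lt_irrefl _ hcon
    rcases lt_or_ge (x : ℕ) p with hxp | hxp
    · have := pre1 (x + 1) hxp x (by omega)
      rw [Fin.le_def] at hge
      apply Fin.ext; omega
    · have b1 := bd1 x hxp
      have b2 := hAp x hxp (by omega)
      have b3 := hν x
      have b4 := eb x
      have hxq : x ≠ q := by intro h; rw [h] at hx; omega
      rw [if_neg hxq] at b4
      by_contra hne'
      have hlt' : x < σ x := lt_of_le_of_ne hge (Ne.symm hne')
      have b5 := hc hlt'
      by_cases hxp' : x = p
      · rw [if_pos hxp'] at b4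
        have b6 := pre3 x (by omega)
        have hltn := Fin.lt_def.1 hlt'
        let y : Fin l := ⟨x + 1, by have := (σ x).2; omega⟩
        have hxy : x < y := by rw [Fin.lt_def]; simp [y]
        have b7 := hc hxy
        have b8 : sh C (σ x) ≤ sh C y := hc.antitone (by rw [Fin.le_def]; simp [y]; omega)
        have b9 := hB hxy.le
        have c1 := e y
        have c2 := e x
        rw [if_neg (by rw [← hxp']; exact hxy.ne'), if_neg (by intro h; have := congrArg Fin.val h; simp [y] at this; omega)] at c1
        rw [if_pos hxp', if_neg hxq] at c2
        have c3 := hAp y (by rw [← hxp']; exact hxy.le) (by simp [y]; omega)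
        have d1 : sh C x = C x + dl l x := rfl
        have d2 : sh C y = C y + dl l y := rfl
        have d3 : dl l x = dl l y + 1 := by have := y.2; simp only [dl, y] at *; omega
        omega
      · rw [if_neg hxp'] at b4
        omega
  apply perm_one_of_ge
  intro x
  rcases lt_or_ge (x : ℕ) j with hxj | hxj
  · rw [low x x rfl hxj]
  by_contra hcon
  rw [not_le] at hcon
  have hltn := Fin.lt_def.1 hcon
  rcases lt_or_ge (q : ℕ) x with hxq | hxq
  · have := (pfx_iff (pre2 x hxq) x).1 hltn
    omega
  · have b1 := bd2 x hxq
    have b2 := hAq x hxj hxq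
    have b3 := hν x
    have b4 := eb x
    have hxp : x ≠ p := by intro h; rw [h] at hxj; omega
    rw [if_neg hxp] at b4
    have b5 := hc hcon
    by_cases hxq' : x = q
    · rw [if_pos hxq'] at b4
      have b6 : j ≤ (σ x : ℕ) := by
        by_contra h
        have := (pfx_iff pre3 x).1 (by omega)
        omega
      let y : Fin l := ⟨x - 1, by have := x.2; omega⟩
      have hxy : y < x := by rw [Fin.lt_def]; simp [y]; omega
      have b7 := hc hxy
      have b8 : sh C y ≤ sh C (σ x) := hc.antitone (by rw [Fin.le_def]; simp [y]; omega)
      have b9 := hB hxy.le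
      have c1 := e y
      have c2 := e x
      rw [if_neg (by intro h; have := congrArg Fin.val h; simp [y] at this; omega), if_neg (by rw [← hxq']; exact hxy.ne)] at c1
      rw [if_neg hxp, if_pos hxq'] at c2
      have c3 := hAq y (by simp [y]; omega) (by rw [← hxq']; exact hxy.le)
      have d1 : sh C x = C x + dl l x := rfl
      have d2 : sh C y = C y + dl l y := rfl
      have d3 : dl l y = dl l x + 1 := by have := x.2; simp only [dl, y] at *; omega
      omega
    · rw [if_neg hxq'] at b4
      omega

/-- defects of partial sums. -/
def dd (a : ℕ → ℤ) (n : ℕ) (B : ℕ → ℤ) (r : ℕ) : ℤ := ∑ i ∈ range r, ((n : ℤ) * a i - B i)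

theorem dd_zero (a : ℕ → ℤ) (n : ℕ) (B : ℕ → ℤ) : dd a n B 0 = 0 := by simp [dd]

theorem dd_succ (a : ℕ → ℤ) (n : ℕ) (B : ℕ → ℤ) (r : ℕ) :
    dd a n B (r+1) = dd a n B r + (n * a r - B r) := by simp only [dd, sum_range_succ]

/-- the cone of dominated weights. -/
structure Cone (l : ℕ) (a : ℕ → ℤ) (n : ℕ) (B : ℕ → ℤ) : Prop where
  anti : ∀ i, i + 1 < l → B (i+1) ≤ B i
  nn : ∀ r, r ≤ l → 0 ≤ dd a n B r
  tot : dd a n B l = 0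

/-- positivity for integer valued sequences. -/
def PosZ {l : ℕ} (A : Fin l → ℕ) (n : ℕ) (B : ℕ → ℤ) : Prop :=
  ∃ B' : Fin l → ℕ, (∀ i : Fin l, (B' i : ℤ) = B i) ∧ Antitone B' ∧ Pos A n B'

/-- the integer sequence of a tuple. -/
def za {l : ℕ} (A : Fin l → ℕ) (i : ℕ) : ℤ := (ex A i : ℤ)

theorem za_coe {l : ℕ} (A : Fin l → ℕ) (i : Fin l) : za A i = A i := by rw [za, ex_coe]

theorem za_nn {l : ℕ} (A : Fin l → ℕ) (i : ℕ) : 0 ≤ za A i := by rw [za]; omega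

theorem za_anti {l : ℕ} {A : Fin l → ℕ} (hA : Antitone A) : Antitone (za A) := by
  intro i j hij
  have := ex_anti hA hij
  simp only [za]; omega

theorem anti_nat {l : ℕ} {B : ℕ → ℤ} (h : ∀ i, i + 1 < l → B (i+1) ≤ B i) {i k : ℕ}
    (hik : i ≤ k) (hk : k < l) : B k ≤ B i := by
  induction k, hik using Nat.le_induction with
  | base => exact le_rfl
  | succ k hk' ih => exact (h k hk).trans (ih (by omega))

theorem Cone.nonneg {l : ℕ} {A : Fin l → ℕ} {n : ℕ} {B : ℕ → ℤ} (h : Cone l (za A) n B)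
    {i : ℕ} (hi : i < l) : 0 ≤ B i := by
  have h1 : 0 ≤ B (l-1) := by
    have h2 := dd_succ (za A) n B (l-1)
    have h3 := h.nn (l-1) (by omega)
    rw [show l - 1 + 1 = l by omega, h.tot] at h2
    have h4 : (0:ℤ) ≤ n * za A (l-1) := mul_nonneg (by omega) (za_nn A _)
    omega
  exact h1.trans (anti_nat h.anti (by omega) (by omega))

theorem exists_nat {l : ℕ} {B : ℕ → ℤ} (h : ∀ i, i + 1 < l → B (i+1) ≤ B i)
    (h0 : ∀ i, i < l → 0 ≤ B i) : ∃ B' : Fin l → ℕ, (∀ i : Fin l, (B' i : ℤ) = B i) ∧ Antitone B' := by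
  refine ⟨fun i => (B i).toNat, fun i => Int.toNat_of_nonneg (h0 i i.2), ?_⟩
  intro i j hij
  exact Int.toNat_le_toNat (anti_nat h (Fin.le_def.1 hij) j.2)

theorem PosZ_nA {l : ℕ} {A : Fin l → ℕ} (hA : Antitone A) (n : ℕ) :
    Pos A n (fun i => n * A i) := by
  induction n with
  | zero => simpa using Pos_zero A
  | succ n ih =>
    have anti : ∀ m : ℕ, Antitone (fun i => m * A i) := fun m i j hij => Nat.mul_le_mul_left m (hA hij)
    apply F1 hA (anti _) (anti n) ih 1
    intro i
    simp only [Equiv.Perm.one_apply]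
    ring

theorem base_step {l : ℕ} {A : Fin l → ℕ} (hA : Antitone A) {n : ℕ} {B : ℕ → ℤ}
    (h : Cone l (za A) n B) (hD : 2 * ∑ r ∈ range l, dd (za A) n B r ≤ n)
    (hne : ∃ r, r ≤ l ∧ dd (za A) n B r ≠ 0) :
    ∃ (m : ℕ) (C : ℕ → ℤ) (p q j : ℕ), n = m + 1 ∧ Cone l (za A) m C ∧
      ∑ r ∈ range l, dd (za A) m C r < ∑ r ∈ range l, dd (za A) n B r ∧
      2 * ∑ r ∈ range l, dd (za A) m C r ≤ m ∧ p < j ∧ j ≤ q ∧ q < l ∧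
      (∀ i, p ≤ i → i < j → za A i = za A p) ∧ (∀ i, j ≤ i → i ≤ q → za A i = za A q) ∧
      za A q < za A p ∧ C j < C (j-1) ∧
      (∀ i, B i + (if i = p then 1 else 0) = C i + za A i + (if i = q then 1 else 0)) := by
  set a := za A with ha
  set d := dd a n B with hd
  have aanti : Antitone a := za_anti hA
  have dsucc : ∀ r, d (r+1) = d r + (n * a r - B r) := dd_succ a n B
  have d0 : d 0 = 0 := dd_zero a n B
  have dl0 : d l = 0 := h.tot
  -- first argmax
  obtain ⟨r₀, hr₀, hr₀'⟩ := hne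
  obtain ⟨j₀, hj₀, hmax⟩ := Finset.exists_max_image (range (l+1)) d ⟨0, by simp⟩
  have exj : ∃ j, j ≤ l ∧ d j = d j₀ := ⟨j₀, by simp at hj₀; omega, rfl⟩
  classical
  obtain ⟨j, ⟨hjl', hjd⟩, hjmin⟩ : ∃ j, (j ≤ l ∧ d j = d j₀) ∧ ∀ k < j, ¬ (k ≤ l ∧ d k = d j₀) :=
    ⟨Nat.find exj, Nat.find_spec exj, fun k hk => Nat.find_min exj hk⟩
  have hmaxj : ∀ r, r ≤ l → d r ≤ d j := fun r hr => by rw [hjd]; exact hmax r (by simp; omega)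
  have hltj : ∀ r, r < j → d r < d j := by
    intro r hr
    refine lt_of_le_of_ne (hmaxj r (by omega)) ?_
    intro he
    exact hjmin r hr ⟨by omega, by rw [he, hjd]⟩
  have hdpos : 0 < d j := by
    have := hmaxj r₀ hr₀
    have h1 : 0 ≤ d r₀ := h.nn r₀ hr₀
    omega
  have hj0 : 0 < j := by
    rcases Nat.eq_zero_or_pos j with h1 | h1
    · rw [h1, d0] at hdpos; omega
    · exact h1
  have hjl : j < l := by
    rcases eq_or_lt_of_le hjl' with h1 | h1
    · rw [h1, dl0] at hdpos; omega
    · exact h1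
  have inc : 1 ≤ n * a (j-1) - B (j-1) := by
    have := dsucc (j-1)
    rw [show j - 1 + 1 = j by omega] at this
    have := hltj (j-1) (by omega)
    omega
  have dec : n * a j - B j ≤ 0 := by
    have := dsucc j
    have := hmaxj (j+1) (by omega)
    omega
  have hBj := h.anti (j-1) (by omega)
  rw [show j - 1 + 1 = j by omega] at hBj
  have haj : a j < a (j-1) := by
    by_contra hcon
    have h1 : a j = a (j-1) := le_antisymm (aanti (by omega)) (by omega)
    rw [h1] at dec
    omega
  -- p
  have exp' : ∃ p, p < j ∧ a p = a (j-1) ∧ B p = B (j-1) := ⟨j-1, by omega, rfl, rfl⟩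
  obtain ⟨p, ⟨hpj, hap, hBp⟩, hpmin⟩ : ∃ p, (p < j ∧ a p = a (j-1) ∧ B p = B (j-1)) ∧
      ∀ k < p, ¬ (k < j ∧ a k = a (j-1) ∧ B k = B (j-1)) :=
    ⟨Nat.find exp', Nat.find_spec exp', fun k hk => Nat.find_min exp' hk⟩
  have exq' : ∃ t, j + t < l ∧ ¬ (j + t + 1 < l ∧ a (j+t+1) = a j ∧ B (j+t+1) = B j) :=
    ⟨l - 1 - j, by omega, by omega⟩
  obtain ⟨t, ⟨htl, htn⟩, htmin⟩ : ∃ t, (j + t < l ∧ ¬ (j + t + 1 < l ∧ a (j+t+1) = a j ∧ B (j+t+1) = B j)) ∧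
      ∀ k < t, ¬ (j + k < l ∧ ¬ (j + k + 1 < l ∧ a (j+k+1) = a j ∧ B (j+k+1) = B j)) :=
    ⟨Nat.find exq', Nat.find_spec exq', fun k hk => Nat.find_min exq' hk⟩
  have conP : ∀ i, p ≤ i → i < j → a i = a (j-1) ∧ B i = B (j-1) := by
    intro i h1 h2
    have e1 := aanti h1
    have e2 := aanti (show i ≤ j - 1 by omega)
    have e3 := anti_nat h.anti h1 (by omega)
    have e4 := anti_nat h.anti (show i ≤ j - 1 by omega) (by omega)
    omega
  have conQ' : ∀ s, s ≤ t → a (j+s) = a j ∧ B (j+s) = B j := by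
    intro s hs
    rcases Nat.eq_zero_or_pos s with h1 | h1
    · subst h1; exact ⟨rfl, rfl⟩
    · have := htmin (s-1) (by omega)
      rw [show j + (s-1) + 1 = j + s by omega] at this
      by_contra hcon
      apply this
      exact ⟨by omega, fun h => hcon h.2⟩
  have conQ : ∀ i, j ≤ i → i ≤ j + t → a i = a j ∧ B i = B j := by
    intro i h1 h2
    have := conQ' (i - j) (by omega)
    rwa [show j + (i - j) = i by omega] at this
  set q := j + t with hq
  -- d ≥ 1 between
  have dlow : ∀ r, p ≤ r → r ≤ j → d p + (r - p) ≤ d r := by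
    intro r h1
    induction r, h1 using Nat.le_induction with
    | base => intro _; omega
    | succ r hr ih =>
      intro h2
      have h3 := ih (by omega)
      have h4 := conP r hr (by omega)
      have h5 := dsucc r
      rw [h4.1, h4.2] at h5
      push_cast
      omega
  have dhigh : ∀ r, j ≤ r → r ≤ q + 1 → d r = d j + (r - j) * (n * a j - B j) := by
    intro r h1
    induction r, h1 using Nat.le_induction with
    | base => intro _; ring
    | succ r hr ih =>
      intro h2
      have h3 := ih (by omega)
      have h4 := conQ r hr (by omega)
      have h5 := dsucc r
      rw [h4.1, h4.2] at h5
      rw [h5, h3]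
      push_cast
      ring
  have dge : ∀ r, p < r → r ≤ q → 1 ≤ d r := by
    intro r h1 h2
    rcases le_total r j with h3 | h3
    · have h4 := dlow r (by omega) h3
      have h5 := h.nn p (by omega)
      change 0 ≤ d p at h5
      omega
    · have e1 := dhigh r h3 (by omega)
      have e2 := dhigh (q+1) (by omega) le_rfl
      have e3 : 0 ≤ d (q+1) := h.nn (q+1) (by omega)
      rcases eq_or_lt_of_le dec with h4 | h4
      · rw [h4, mul_zero] at e1; omega
      · have e4 : d r = d (q+1) + ((q:ℤ) + 1 - r) * (-(n * a j - B j)) := by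
          rw [e1, e2]; push_cast; ring
        have e5 : (0:ℤ) < ((q:ℤ) + 1 - r) * (-(n * a j - B j)) :=
          mul_pos (by omega) (by omega)
        omega
  have hn1 : 1 ≤ n := by
    have : d j ≤ ∑ r ∈ range l, d r :=
      Finset.single_le_sum (f := d) (fun r hr => h.nn r (by simp at hr; omega)) (by simp; exact hjl)
    omega
  obtain ⟨m, rfl⟩ : ∃ m, n = m + 1 := ⟨n - 1, by omega⟩
  let C : ℕ → ℤ := fun i => B i - a i + (if i = p then 1 else 0) - (if i = q then 1 else 0)
  have hdC : ∀ r, dd a m C r = d r - (if p < r ∧ r ≤ q then 1 else 0) := by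
    intro r
    induction r with
    | zero => rw [dd_zero, d0]; simp
    | succ r ih =>
      rw [dd_succ, dsucc, ih]
      have e : ((m + 1 : ℕ) : ℤ) * a r = m * a r + a r := by push_cast; ring
      rw [e]
      simp only [C]
      split_ifs <;> omega
  have hle : ∀ r ∈ range l, dd a m C r ≤ d r := by
    intro r _
    rw [hdC]; split_ifs <;> omega
  have hnnC : ∀ r, r ≤ l → 0 ≤ dd a m C r := by
    intro r hr
    rw [hdC]
    have := h.nn r hr
    change 0 ≤ d r at this
    split_ifs with h1
    · have := dge r h1.1 h1.2; omega
    · omega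
  have hlt : ∑ r ∈ range l, dd a m C r < ∑ r ∈ range l, d r := by
    apply Finset.sum_lt_sum hle
    refine ⟨j, by simp; exact hjl, ?_⟩
    rw [hdC, if_pos (by omega)]
    omega
  have gapC : ∀ i, i + 1 < l → a (i+1) < a i → C (i+1) < C i := by
    intro i hi hai
    have e1 := dd_succ a m C i
    have e2 := dd_succ a m C (i+1)
    have e3 := hnnC i (by omega)
    have e4 := hnnC (i+1+1) (by omega)
    have e5 : dd a m C (i+1) ≤ ∑ r ∈ range l, dd a m C r :=
      Finset.single_le_sum (f := dd a m C) (fun r hr => hnnC r (by simp at hr; omega)) (by simp; exact hi)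
    have e6 : (m : ℤ) * 1 ≤ m * (a i - a (i+1)) :=
      mul_le_mul_of_nonneg_left (by omega) (by omega)
    rw [mul_sub] at e6
    push_cast at hD
    omega
  refine ⟨m, C, p, q, j, rfl, ⟨?_, hnnC, ?_⟩, hlt, ?_, hpj, by omega, htl, ?_, ?_, ?_, ?_, ?_⟩
  · intro i hi
    by_cases hai : a (i+1) < a i
    · exact (gapC i hi hai).le
    · have hai' : a (i+1) = a i := le_antisymm (aanti (by omega)) (by omega)
      have hBi := h.anti i hi
      have c1 : i + 1 = p → B (i+1) < B i := by
        intro h1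
        refine lt_of_le_of_ne hBi ?_
        intro h2
        apply hpmin i (by omega)
        rw [← hai', ← h2, h1]
        exact ⟨by omega, hap, hBp⟩
      have c2 : i = q → B (i+1) < B i := by
        intro h1
        refine lt_of_le_of_ne hBi ?_
        intro h2
        apply htn
        rw [← h1, h2, hai']
        have := conQ i (by omega) (by omega)
        exact ⟨hi, this⟩
      simp only [C]
      split_ifs <;> omega
  · rw [hdC, dl0, if_neg (by omega)]; rfl
  · push_cast at hD; omega
  · intro i h1 h2; rw [(conP i h1 h2).1, hap]
  · intro i h1 h2; rw [(conQ i h1 h2).1, (conQ q (by omega) le_rfl).1]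
  · rw [(conQ q (by omega) le_rfl).1, hap]; exact haj
  · have := gapC (j-1) (by omega)
    rw [show j - 1 + 1 = j by omega] at this
    exact this haj
  · intro i
    simp only [C]
    ring

theorem base {l : ℕ} {A : Fin l → ℕ} (hA : Antitone A) (D : ℕ) : ∀ {n : ℕ} {B : ℕ → ℤ}
    (_ : Cone l (za A) n B) (_ : ∑ r ∈ range l, dd (za A) n B r ≤ D)
    (_ : 2 * ∑ r ∈ range l, dd (za A) n B r ≤ n), PosZ A n B := by
  induction D with
  | zero =>
    intro n B h h1 h2
    have hz : ∀ r, r ≤ l → dd (za A) n B r = 0 := by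
      intro r hr
      rcases eq_or_lt_of_le hr with h3 | h3
      · rw [h3]; exact h.tot
      · have := Finset.single_le_sum (f := dd (za A) n B) (s := range l)
          (fun r hr => h.nn r (by simp at hr; omega)) (a := r) (by simp; exact h3)
        have := h.nn r hr
        push_cast at h1
        omega
    refine ⟨fun i => n * A i, ?_, fun i j hij => Nat.mul_le_mul_left n (hA hij), PosZ_nA hA n⟩
    intro i
    have h3 := dd_succ (za A) n B i
    rw [hz i (by omega), hz (i+1) (by omega), za_coe] at h3
    push_cast
    omega
  | succ D ih =>
    intro n B h h1 h2
    by_cases hne : ∃ r, r ≤ l ∧ dd (za A) n B r ≠ 0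
    · obtain ⟨m, C, p, q, j, rfl, hC, hlt, hDm, hpj, hjq, hql, hp, hq, hpq, hCj, e⟩ :=
        base_step hA h h2 hne
      obtain ⟨C', hC'1, hC'2, hC'3⟩ := ih hC (by push_cast at h1; omega) hDm
      obtain ⟨B', hB'1, hB'2⟩ := exists_nat h.anti (fun i hi => h.nonneg hi)
      refine ⟨B', hB'1, hB'2, ?_⟩
      refine F2 hA hB'2 hC'2 hC'3 ⟨p, by omega⟩ ⟨q, hql⟩ j hpj hjq ?_ ?_ ?_ ?_ ?_
      · intro i h3 h4
        have := hp i (Fin.le_def.1 h3) h4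
        rw [za_coe] at this
        have h5 := za_coe A ⟨p, by omega⟩
        simp only at h5
        omega
      · intro i h3 h4
        have := hq i h3 (Fin.le_def.1 h4)
        rw [za_coe] at this
        have h5 := za_coe A ⟨q, hql⟩
        simp only at h5
        omega
      · have h5 := za_coe A ⟨q, hql⟩
        have h6 := za_coe A ⟨p, by omega⟩
        simp only at h5 h6
        omega
      · intro i k hi hk
        have h3 := hC'1 i
        have h4 := hC'1 k
        have h5 := anti_nat hC.anti hk k.2
        have h6 := anti_nat hC.anti (show (i:ℕ) ≤ j - 1 by omega) (by omega)
        omega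
      · intro i
        have h3 := e i
        rw [← hB'1, ← hC'1, za_coe] at h3
        simp only [Fin.ext_iff]
        split_ifs at * <;> omega
    · push Not at hne
      apply ih h _ h2
      rw [Finset.sum_eq_zero (fun r hr => hne r (by simp at hr; omega))]
      omega

/-- adjacent transposition. -/
def adj {l : ℕ} (k : ℕ) (hk : k + 1 < l) : Equiv.Perm (Fin l) :=
  Equiv.swap ⟨k, by omega⟩ ⟨k+1, hk⟩

/-- sum over a set of permutations. -/
def vU {l : ℕ} (A : Fin l → ℕ) (U : Finset (Equiv.Perm (Fin l))) (i : Fin l) : ℕ := ∑ w ∈ U, A (w i)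

/-- closure condition. -/
structure Upc {l : ℕ} (N : ℕ → Prop) (U : Finset (Equiv.Perm (Fin l))) : Prop where
  one : 1 ∈ U
  pre : ∀ w ∈ U, ∀ r, ¬ N r → ∀ i : Fin l, (i : ℕ) < r → (w i : ℕ) < r
  up : ∀ w ∈ U, ∀ k (hk : k + 1 < l), N (k+1) → w ⟨k+1, hk⟩ < w ⟨k, by omega⟩ → w * adj k hk ∈ U

theorem vU_anti {l : ℕ} {A : Fin l → ℕ} (hA : Antitone A) {N : ℕ → Prop}
    {U : Finset (Equiv.Perm (Fin l))} (hU : Upc N U) : Antitone (vU A U) := by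
  classical
  apply anti_of_succ
  intro k hk
  by_cases hN : N (k+1)
  · let x : Fin l := ⟨k, by omega⟩
    let y : Fin l := ⟨k+1, hk⟩
    have hxy : x ≠ y := by intro h; simp [x, y, Fin.ext_iff] at h
    let f : Equiv.Perm (Fin l) → ℤ := fun w => (A (w x) : ℤ) - A (w y)
    have hf : ∀ w, f (w * adj k hk) = - f w := by
      intro w
      simp only [f, Equiv.Perm.mul_apply, adj, x, y, Equiv.swap_apply_left, Equiv.swap_apply_right]
      ring
    have h1 : ∑ w ∈ U.filter (fun w => w y < w x), f (w * adj k hk) ≤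
        ∑ w ∈ U.filter (fun w => ¬ w y < w x), f w := by
      rw [← Finset.sum_image (f := f) (g := fun w => w * adj k hk) (by
        intro a _ b _ hab; exact mul_right_cancel hab)]
      apply Finset.sum_le_sum_of_subset_of_nonneg
      · intro w hw
        simp only [mem_image, mem_filter] at hw ⊢
        obtain ⟨w', ⟨h1, h2⟩, rfl⟩ := hw
        refine ⟨hU.up w' h1 k hk hN h2, ?_⟩
        simp only [Equiv.Perm.mul_apply, adj, x, y, Equiv.swap_apply_left, Equiv.swap_apply_right] at *
        exact not_lt.2 h2.le
      · intro w hw _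
        simp only [mem_filter, not_lt] at hw
        have := hA hw.2
        simp only [f]
        omega
    have h2 := Finset.sum_filter_add_sum_filter_not U (fun w => w y < w x) f
    simp only [hf, Finset.sum_neg_distrib] at h1
    have h3 : ∑ w ∈ U, f w = (vU A U x : ℤ) - vU A U y := by
      simp only [f, vU, Finset.sum_sub_distrib]
      push_cast; rfl
    show vU A U y ≤ vU A U x
    omega
  · apply Finset.sum_le_sum
    intro w hw
    apply hA
    have h1 := hU.pre w hw (k+1) hN ⟨k, by omega⟩ (by simp)
    have h2 := pfx_iff (hU.pre w hw (k+1) hN) ⟨k+1, hk⟩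
    simp only [lt_irrefl, iff_false, not_lt] at h2
    rw [Fin.le_def]
    omega

/-- statistic used to order permutations. -/
def phi {l : ℕ} (w : Equiv.Perm (Fin l)) : ℤ := ∑ i : Fin l, ((i : ℕ) : ℤ) * ((w i : ℕ) : ℤ)

theorem phi_lt {l : ℕ} (w : Equiv.Perm (Fin l)) (k : ℕ) (hk : k + 1 < l)
    (h : w ⟨k+1, hk⟩ < w ⟨k, by omega⟩) : phi w < phi (w * adj k hk) := by
  let x : Fin l := ⟨k, by omega⟩
  let y : Fin l := ⟨k+1, hk⟩
  have hxy : x ≠ y := by intro h; simp [x, y, Fin.ext_iff] at h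
  have e : phi (w * adj k hk) - phi w =
      ∑ i : Fin l, ((((w * adj k hk) i : ℕ) : ℤ) - ((w i : ℕ) : ℤ)) * ((i : ℕ) : ℤ) := by
    simp only [phi]
    rw [← Finset.sum_sub_distrib]
    exact Finset.sum_congr rfl fun i _ => by ring
  rw [Fintype.sum_eq_add x y hxy] at e
  · simp only [Equiv.Perm.mul_apply, adj, x, y, Equiv.swap_apply_left, Equiv.swap_apply_right] at e
    rw [Fin.lt_def] at h
    push_cast at e
    have e2 : phi (w * adj k hk) - phi w = (w ⟨k, by omega⟩ : ℕ) - (w ⟨k+1, hk⟩ : ℕ) := by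
      rw [adj, e]; ring
    omega
  · rintro i ⟨h1, h2⟩
    rw [Equiv.Perm.mul_apply, adj, Equiv.swap_apply_of_ne_of_ne h1 h2]
    ring

theorem orbit {l : ℕ} {A : Fin l → ℕ} (hA : Antitone A) {N : ℕ → Prop} {n : ℕ} {C : Fin l → ℕ}
    (hC : Antitone C) (hp : Pos A n (fun i => C i + A i)) (s : ℕ) :
    ∀ U : Finset (Equiv.Perm (Fin l)), Upc N U → U.card = s + 1 →
      Pos A (n + s) (fun i => C i + vU A U i) := by
  classical
  induction s with
  | zero =>
    intro U hU hc
    obtain ⟨w, rfl⟩ := Finset.card_eq_one.1 hc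
    have : w = 1 := (Finset.mem_singleton.1 hU.one).symm
    subst this
    simpa [vU] using hp
  | succ s ih =>
    intro U hU hc
    have hne : (U.erase 1).Nonempty := by
      rw [← Finset.card_pos, Finset.card_erase_of_mem hU.one]; omega
    obtain ⟨w₀, hw₀, hmin⟩ := Finset.exists_min_image (U.erase 1) phi hne
    have hw₀1 := Finset.mem_erase.1 hw₀
    have hU' : Upc N (U.erase w₀) := by
      refine ⟨Finset.mem_erase.2 ⟨hw₀1.1.symm, hU.one⟩, fun w hw => hU.pre w (Finset.mem_of_mem_erase hw), ?_⟩
      intro w hw k hk hN hlt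
      have hwU := Finset.mem_of_mem_erase hw
      refine Finset.mem_erase.2 ⟨?_, hU.up w hwU k hk hN hlt⟩
      intro heq
      have h1 := phi_lt w k hk hlt
      rw [heq] at h1
      have hw1 : w ≠ 1 := by
        rintro rfl
        simp at hlt
      have := hmin w (Finset.mem_erase.2 ⟨hw1, hwU⟩)
      omega
    have h1 := ih (U.erase w₀) hU' (by rw [Finset.card_erase_of_mem hw₀1.2]; omega)
    have := F1 hA (B := fun i => C i + vU A U i) (fun i j hij => add_le_add (hC hij) (vU_anti hA hU hij))
      (fun i j hij => add_le_add (hC hij) (vU_anti hA hU' hij)) h1 w₀ (by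
        intro i
        simp only [vU]
        rw [← Finset.sum_erase_add U _ hw₀1.2]
        ring)
    exact this

open scoped Classical in
/-- parabolic subgroup. -/
noncomputable def WN (l : ℕ) (N : ℕ → Prop) : Finset (Equiv.Perm (Fin l)) :=
  Finset.univ.filter fun w => ∀ r, ¬ N r → ∀ i : Fin l, (i : ℕ) < r → (w i : ℕ) < r

theorem mem_WN {l : ℕ} {N : ℕ → Prop} {w : Equiv.Perm (Fin l)} :
    w ∈ WN l N ↔ ∀ r, ¬ N r → ∀ i : Fin l, (i : ℕ) < r → (w i : ℕ) < r := by
  simp [WN]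

theorem adj_pre {l : ℕ} (k : ℕ) (hk : k + 1 < l) (r : ℕ) (hr : r ≠ k + 1) (i : Fin l) (hi : (i : ℕ) < r) :
    (adj k hk i : ℕ) < r := by
  rw [adj]
  by_cases h1 : i = ⟨k, by omega⟩
  · rw [h1, Equiv.swap_apply_left]
    have := congrArg Fin.val h1
    simp only at *
    omega
  · by_cases h2 : i = ⟨k+1, hk⟩
    · rw [h2, Equiv.swap_apply_right]
      have := congrArg Fin.val h2
      simp only at *
      omega
    · rw [Equiv.swap_apply_of_ne_of_ne h1 h2]; exact hi

theorem WN_mul_adj {l : ℕ} {N : ℕ → Prop} {w : Equiv.Perm (Fin l)} (hw : w ∈ WN l N) (k : ℕ)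
    (hk : k + 1 < l) (hN : N (k+1)) : w * adj k hk ∈ WN l N := by
  rw [mem_WN] at *
  intro r hr i hi
  rw [Equiv.Perm.mul_apply]
  apply hw r hr
  apply adj_pre _ _ _ _ _ hi
  intro h; rw [h] at hr; exact hr hN

theorem WN_upc (l : ℕ) (N : ℕ → Prop) : Upc N (WN l N) where
  one := by
    rw [mem_WN]; intro r _ i hi; exact hi
  pre w hw := mem_WN.1 hw
  up w hw k hk hN _ := WN_mul_adj hw k hk hN

theorem WN_card_pos (l : ℕ) (N : ℕ → Prop) : 0 < (WN l N).card :=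
  Finset.card_pos.2 ⟨1, (WN_upc l N).one⟩

theorem WN_card_le (l : ℕ) (N : ℕ → Prop) : (WN l N).card ≤ l.factorial := by
  refine (Finset.card_le_univ _).trans ?_
  rw [Fintype.card_perm, Fintype.card_fin]

theorem za_sum {l : ℕ} (A : Fin l → ℕ) (r : ℕ) (hr : r ≤ l) :
    ∑ i ∈ range r, za A i = ((ps A r : ℕ) : ℤ) := by
  rw [ps_ex A r hr]; push_cast; rfl

theorem ps_vU {l : ℕ} (A : Fin l → ℕ) (U : Finset (Equiv.Perm (Fin l))) (r : ℕ) :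
    ps (vU A U) r = ∑ w ∈ U, ps (A ∘ w) r := by
  simp only [ps, vU]
  rw [Finset.sum_comm]
  rfl

theorem dd_vU {l : ℕ} (A : Fin l → ℕ) (U : Finset (Equiv.Perm (Fin l))) (r : ℕ) (hr : r ≤ l) :
    dd (za A) U.card (za (vU A U)) r = U.card * ((ps A r : ℕ) : ℤ) - ((∑ w ∈ U, ps (A ∘ w) r : ℕ) : ℤ) := by
  rw [dd, Finset.sum_sub_distrib, ← Finset.mul_sum, za_sum _ r hr, za_sum _ r hr, ps_vU]

theorem ps_le_total {l : ℕ} (A : Fin l → ℕ) (r : ℕ) : ps A r ≤ ∑ i, A i :=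
  Finset.sum_le_sum_of_subset (Finset.subset_univ _)

theorem dd_vU_zero {l : ℕ} (A : Fin l → ℕ) (N : ℕ → Prop) (r : ℕ) (hr : r ≤ l) (hN : ¬ N r) :
    dd (za A) (WN l N).card (za (vU A (WN l N))) r = 0 := by
  rw [dd_vU A _ r hr]
  have : ∑ w ∈ WN l N, ps (A ∘ w) r = ∑ w ∈ WN l N, ps A r :=
    Finset.sum_congr rfl fun w hw => ps_perm A (mem_WN.1 hw r hN)
  rw [this, Finset.sum_const, smul_eq_mul]
  push_cast
  ring

theorem dd_vU_le {l : ℕ} (A : Fin l → ℕ) (N : ℕ → Prop) (r : ℕ) (hr : r ≤ l) :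
    dd (za A) (WN l N).card (za (vU A (WN l N))) r ≤ ((l.factorial * ∑ i, A i : ℕ) : ℤ) := by
  rw [dd_vU A _ r hr]
  have h : (WN l N).card * ps A r ≤ l.factorial * ∑ i, A i :=
    Nat.mul_le_mul (WN_card_le l N) (ps_le_total A r)
  have h2 : (((WN l N).card * ps A r : ℕ) : ℤ) = (WN l N).card * ((ps A r : ℕ) : ℤ) := by push_cast; rfl
  omega

theorem vU_le {l : ℕ} (A : Fin l → ℕ) (N : ℕ → Prop) (i : ℕ) :
    za (vU A (WN l N)) i ≤ ((l.factorial * ∑ i, A i : ℕ) : ℤ) := by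
  rw [za]
  by_cases hi : i < l
  · simp only [ex, hi, dif_pos]
    have : vU A (WN l N) ⟨i, hi⟩ ≤ (WN l N).card * ∑ i, A i := by
      rw [vU, ← smul_eq_mul, ← Finset.sum_const]
      apply Finset.sum_le_sum
      intro w _
      exact Finset.single_le_sum (f := A) (fun _ _ => Nat.zero_le _) (Finset.mem_univ _)
    have h2 := this.trans (Nat.mul_le_mul_right _ (WN_card_le l N))
    exact_mod_cast h2
  · rw [ex_ge _ _ (by omega)]
    push_cast
    positivity

theorem vU_gap_N {l : ℕ} (A : Fin l → ℕ) (N : ℕ → Prop) (k : ℕ) (hk : k + 1 < l) (hN : N (k+1)) :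
    za (vU A (WN l N)) k = za (vU A (WN l N)) (k+1) := by
  simp only [za, ex, hk, show k < l by omega, dif_pos, vU]
  congr 1
  have hadj : adj k hk * adj k hk = 1 := by rw [adj, Equiv.swap_mul_self]
  refine Finset.sum_nbij' (fun w => w * adj k hk) (fun w => w * adj k hk) ?_ ?_ ?_ ?_ ?_
  · intro w hw; exact WN_mul_adj hw k hk hN
  · intro w hw; exact WN_mul_adj hw k hk hN
  · intro w _; rw [mul_assoc, hadj, mul_one]
  · intro w _; rw [mul_assoc, hadj, mul_one]
  · intro w _
    simp [adj]

theorem vU_fix {l : ℕ} (A : Fin l → ℕ) (N : ℕ → Prop) (k : ℕ) (hk : k < l) (h1 : ¬ N k)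
    (h2 : ¬ N (k+1)) : za (vU A (WN l N)) k = (WN l N).card * za A k := by
  have h : vU A (WN l N) ⟨k, hk⟩ = (WN l N).card * A ⟨k, hk⟩ := by
    rw [vU, ← smul_eq_mul, ← Finset.sum_const]
    refine Finset.sum_congr rfl fun w hw => ?_
    rw [mem_WN] at hw
    have a1 := hw (k+1) h2 ⟨k, hk⟩ (by simp)
    have a2 := pfx_iff (hw k h1) ⟨k, hk⟩
    simp only [lt_irrefl, iff_false, not_lt] at a2
    congr 1
    apply Fin.ext
    simp only
    omega
  simp only [za, ex, hk, dif_pos, h]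
  push_cast
  rfl

/-- thresholds. -/
def TT (G : ℤ) : ℕ → ℤ
  | 0 => 0
  | i+1 => 2 * TT G i + G

theorem TT_nn (G : ℤ) (hG : 0 ≤ G) (i : ℕ) : 0 ≤ TT G i := by
  induction i with
  | zero => exact le_rfl
  | succ i ih => simp only [TT]; omega

theorem TT_mono (G : ℤ) (hG : 0 ≤ G) : Monotone (TT G) := by
  apply monotone_nat_of_le_succ
  intro i
  have := TT_nn G hG i
  simp only [TT]; omega

theorem pigeon (l : ℕ) (hl : 0 < l) (d T : ℕ → ℤ) (hT : Monotone T) :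
    ∃ i, i < l ∧ ∀ r, 1 ≤ r → r < l → ¬ (T i ≤ d r ∧ d r < T (i+1)) := by
  by_contra hcon
  push Not at hcon
  choose! f h1 h2 h3 using hcon
  obtain ⟨x, hx, y, hy, hxy, he⟩ := Finset.exists_ne_map_eq_of_card_lt_of_maps_to
    (s := range l) (t := Finset.Ico 1 l) (f := f) (by simp; omega)
    (by intro i hi; simp only [coe_range, Set.mem_Iio, coe_Ico, Set.mem_Ico] at *; exact ⟨h1 i hi, h2 i hi⟩)
  simp only [mem_range] at hx hy
  have a := h3 x hx
  have b := h3 y hy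
  rw [he] at a
  rcases lt_or_gt_of_ne hxy with h | h
  · have := hT (show x + 1 ≤ y from h); omega
  · have := hT (show y + 1 ≤ x from h); omega

theorem reduction {l : ℕ} (hl : 0 < l) {A : Fin l → ℕ} (hA : Antitone A) {n : ℕ} {B : ℕ → ℤ}
    (h : Cone l (za A) n B) (G : ℤ) (hG : G = ((l.factorial * ∑ i, A i : ℕ) : ℤ) + 1)
    (hn : 2 * TT G l + G + l.factorial ≤ n) :
    ∃ N : ℕ → Prop, (WN l N).card ≤ n ∧
      Cone l (za A) (n - (WN l N).card) (fun i => B i - za (vU A (WN l N)) i) := by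
  have hG1 : 1 ≤ G := by omega
  obtain ⟨t, htl, ht⟩ := pigeon l hl (dd (za A) n B) (TT G) (TT_mono G (by omega))
  set d := dd (za A) n B with hd
  have d0 : d 0 = 0 := dd_zero _ _ _
  have dl0 : d l = 0 := h.tot
  have dnn : ∀ r, r ≤ l → 0 ≤ d r := h.nn
  have Tnn := TT_nn G (by omega) t
  have Tl := TT_mono G (by omega) (show t ≤ l by omega)
  have Ts : TT G (t+1) = 2 * TT G t + G := rfl
  let N : ℕ → Prop := fun r => r ≤ l ∧ TT G (t+1) ≤ d r
  have hN0 : ¬ N 0 := by rintro ⟨_, h2⟩; rw [d0] at h2; omega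
  have hNl : ¬ N l := by rintro ⟨_, h2⟩; rw [dl0] at h2; omega
  have hNd : ∀ r, r ≤ l → ¬ N r → d r ≤ TT G t := by
    intro r hr hN
    have h1 : d r < TT G (t+1) := by
      by_contra hc; exact hN ⟨hr, by omega⟩
    rcases Nat.eq_zero_or_pos r with h2 | h2
    · rw [h2, d0]; exact Tnn
    · rcases eq_or_lt_of_le hr with h3 | h3
      · rw [h3, dl0]; exact Tnn
      · by_contra hc
        exact ht r h2 h3 ⟨by omega, h1⟩
  have hsl := WN_card_le l N
  set s := (WN l N).card with hs
  set g := za (vU A (WN l N)) with hg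
  have hsn : s ≤ n := by
    have : 0 ≤ TT G l := TT_nn G (by omega) l
    omega
  have hdd : ∀ r, dd (za A) (n - s) (fun i => B i - g i) r = d r - dd (za A) s g r := by
    intro r
    rw [hd, dd, dd, dd, ← Finset.sum_sub_distrib]
    refine Finset.sum_congr rfl fun i _ => ?_
    rw [Nat.cast_sub hsn]
    ring
  refine ⟨N, hsn, ?_, ?_, ?_⟩
  · intro k hk
    show B (k+1) - g (k+1) ≤ B k - g k
    by_cases hN : N (k+1)
    · have hgap : g k = g (k+1) := vU_gap_N A N k hk hN
      have := h.anti k hk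
      omega
    · have b1 := hNd (k+1) (by omega) hN
      have b2 : d (k+1) = d k + (n * za A k - B k) := dd_succ _ _ _ _
      have b3 : d (k+1+1) = d (k+1) + (n * za A (k+1) - B (k+1)) := dd_succ _ _ _ _
      have b4 := dnn k (by omega)
      have b5 := dnn (k+1+1) (by omega)
      have b6 : g k ≤ G := by
        have h0 : g k ≤ ((l.factorial * ∑ i, A i : ℕ) : ℤ) := vU_le A N k
        omega
      have b7 : 0 ≤ g (k+1) := za_nn _ _
      have hanti := h.anti k hk
      by_cases ha : za A (k+1) < za A k
      · have e6 : (n : ℤ) * 1 ≤ n * (za A k - za A (k+1)) :=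
          mul_le_mul_of_nonneg_left (by omega) (by omega)
        rw [mul_sub] at e6
        omega
      · have ha' : za A (k+1) = za A k := le_antisymm (za_anti hA (by omega)) (by omega)
        rw [ha'] at b3
        by_cases hNk : N k
        · have := hNk.2
          omega
        · by_cases hNk2 : N (k+1+1)
          · have := hNk2.2
            omega
          · have c1 : g k = s * za A k := vU_fix A N k (by omega) hNk hN
            have c2 : g (k+1) = s * za A (k+1) := vU_fix A N (k+1) hk hN hNk2
            rw [ha'] at c2
            omega
  · intro r hr
    rw [hdd]
    by_cases hN : N r
    · have h1 : dd (za A) s g r ≤ ((l.factorial * ∑ i, A i : ℕ) : ℤ) := dd_vU_le A N r hr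
      have h2 := hN.2
      omega
    · have h1 : dd (za A) s g r = 0 := dd_vU_zero A N r hr hN
      have h2 := dnn r hr
      omega
  · rw [hdd, dl0]
    have h1 : dd (za A) s g l = 0 := dd_vU_zero A N l le_rfl hNl
    omega

theorem dd_le {l : ℕ} {A : Fin l → ℕ} {n : ℕ} {B : ℕ → ℤ} (h : Cone l (za A) n B) (r : ℕ) (hr : r ≤ l) :
    dd (za A) n B r ≤ n * ((∑ i, A i : ℕ) : ℤ) := by
  rw [dd, Finset.sum_sub_distrib, ← Finset.mul_sum, za_sum A r hr]
  have h1 : (0:ℤ) ≤ ∑ i ∈ range r, B i :=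
    Finset.sum_nonneg fun i hi => h.nonneg (by simp at hi; omega)
  have h2 : (n : ℤ) * ((ps A r : ℕ) : ℤ) ≤ n * ((∑ i, A i : ℕ) : ℤ) :=
    mul_le_mul_of_nonneg_left (by exact_mod_cast ps_le_total A r) (by omega)
  omega

theorem dd_shift (a : ℕ → ℤ) (n m : ℕ) (B : ℕ → ℤ) (r : ℕ) :
    dd a (n+m) (fun i => B i + m * a i) r = dd a n B r := by
  rw [dd, dd]
  refine Finset.sum_congr rfl fun i _ => ?_
  push_cast; ring

theorem Cone.shift {l : ℕ} {a : ℕ → ℤ} (ha : Antitone a) {n : ℕ} {B : ℕ → ℤ} (h : Cone l a n B) (m : ℕ) :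
    Cone l a (n+m) (fun i => B i + m * a i) where
  anti i hi := add_le_add (h.anti i hi) (mul_le_mul_of_nonneg_left (ha (by omega)) (by omega))
  nn r hr := by rw [dd_shift]; exact h.nn r hr
  tot := by rw [dd_shift]; exact h.tot

theorem main_ind {l : ℕ} (hl : 0 < l) {A : Fin l → ℕ} (hA : Antitone A) (G : ℤ) (K : ℕ)
    (hG : G = ((l.factorial * ∑ i, A i : ℕ) : ℤ) + 1)
    (hK : 2 * TT G l + G + l.factorial ≤ K) (n : ℕ) :
    ∀ (m : ℕ) (B : ℕ → ℤ), Cone l (za A) n B →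
      K + l.factorial * (2 * (l * (K * ∑ i, A i))) ≤ m * l.factorial + n →
      PosZ A (n+m) (fun i => B i + m * za A i) := by
  induction n using Nat.strong_induction_on with
  | _ n ih =>
  intro m B h hm
  by_cases hnK : K ≤ n
  · obtain ⟨N, hsn, hc⟩ := reduction hl hA h G hG (by omega)
    have hs0 := WN_card_pos l N
    have hsl := WN_card_le l N
    obtain ⟨X, hX1, hX2, hX3⟩ := ih (n - (WN l N).card) (by omega) (m+1) _ hc (by
      rw [add_mul, one_mul]; omega)
    have hc' := hc.shift (za_anti hA) m
    obtain ⟨C, hC1, hC2⟩ := exists_nat hc'.anti (fun i hi => hc'.nonneg hi)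
    have hXC : X = fun i => C i + A i := by
      funext i
      have a1 := hX1 i
      have a2 := hC1 i
      beta_reduce at a1 a2
      rw [za_coe A i] at a1 a2
      have : ((m + 1 : ℕ) : ℤ) * A i = m * A i + A i := by push_cast; ring
      omega
    rw [hXC] at hX3
    have key := orbit hA hC2 hX3 ((WN l N).card - 1) (WN l N) (WN_upc l N) (by omega)
    rw [show n - (WN l N).card + (m + 1) + ((WN l N).card - 1) = n + m by omega] at key
    refine ⟨_, ?_, ?_, key⟩
    · intro i
      have a2 := hC1 i
      beta_reduce at a2 ⊢
      have a3 := za_coe (vU A (WN l N)) i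
      push_cast
      omega
    · intro i j hij
      exact add_le_add (hC2 hij) (vU_anti hA (WN_upc l N) hij)
  · have hfac : 0 < l.factorial := Nat.factorial_pos l
    have hm2 : 2 * (l * (K * ∑ i, A i)) ≤ m := by
      by_contra hcon
      have : m * l.factorial ≤ l.factorial * (2 * (l * (K * ∑ i, A i))) := by
        rw [mul_comm]; exact Nat.mul_le_mul_left _ (by omega)
      omega
    have hc := h.shift (za_anti hA) m
    have hsum : ∑ r ∈ range l, dd (za A) (n+m) (fun i => B i + m * za A i) r ≤
        ((l * (K * ∑ i, A i) : ℕ) : ℤ) := by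
      have : ∀ r ∈ range l, dd (za A) (n+m) (fun i => B i + m * za A i) r ≤ ((K * ∑ i, A i : ℕ) : ℤ) := by
        intro r hr
        rw [dd_shift]
        refine (dd_le h r (by simp at hr; omega)).trans ?_
        rw [Nat.cast_mul]
        exact mul_le_mul_of_nonneg_right (by omega) (by omega)
      refine (Finset.sum_le_card_nsmul _ _ _ this).trans ?_
      rw [card_range, nsmul_eq_mul]
      push_cast
      exact le_rfl
    exact base hA _ hc hsum (by omega)

theorem main_thm (l : ℕ) (hl : 0 < l) (A : Fin l → ℕ)
    (hA : Antitone A) :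
    ∃ N : ℕ, 0 < N ∧ ∀ n : ℕ, N ≤ n → ∀ B : Fin l → ℕ, Antitone B →
      (∑ i, B i) = n * (∑ i, A i) → Dom l (fun i => n * A i) B →
      0 < schurMult l B ((schur l A) ^ n) := by
  let G : ℤ := ((l.factorial * ∑ i, A i : ℕ) : ℤ) + 1
  let K : ℕ := (2 * TT G l + G + l.factorial).toNat
  have hK : 2 * TT G l + G + l.factorial ≤ K := Int.self_le_toNat _
  refine ⟨K + l.factorial * (2 * (l * (K * ∑ i, A i))) + 1, by omega, ?_⟩
  intro n hn B hB htot hdom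
  have hps : ∀ r, r ≤ l → dd (za A) n (za B) r = n * ((ps A r : ℕ) : ℤ) - ((ps B r : ℕ) : ℤ) := by
    intro r hr
    rw [dd, Finset.sum_sub_distrib, ← Finset.mul_sum, za_sum _ r hr, za_sum _ r hr]
  have hc : Cone l (za A) n (za B) := by
    refine ⟨fun i _ => za_anti hB (by omega), ?_, ?_⟩
    · intro r hr
      rw [hps r hr]
      have h1 := hdom r
      rw [← Finset.mul_sum] at h1
      have h2 : ps B r ≤ n * ps A r := h1
      have h3 : ((ps B r : ℕ) : ℤ) ≤ ((n * ps A r : ℕ) : ℤ) := by exact_mod_cast h2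
      push_cast at h3 ⊢
      linarith
    · rw [hps l le_rfl, ps_total _ l le_rfl, ps_total _ l le_rfl, htot]
      push_cast; ring
  obtain ⟨B', h1, _, h3⟩ := main_ind hl hA G K rfl hK n 0 (za B) hc (by omega)
  have : B' = B := by
    funext i
    have h4 := h1 i
    simp only [za_coe, Nat.cast_zero, zero_mul, add_zero] at h4
    exact_mod_cast h4
  rw [this] at h3
  exact h3

/-- For every positive integer `l` and every partition `A` of length at
most `l`, there is `N_A > 0` such that for all `n ≥ N_A`, every partition `B` of length at
most `l` with `|B| = n|A|` and `B ⪯ nA` in the dominance order has positive multiplicity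
in `(s_A)^n`. -/
theorem schur_power_contains_all_dominated (l : ℕ) (hl : 0 < l) (A : Fin l → ℕ)
    (hA : Antitone A) :
    ∃ N : ℕ, 0 < N ∧ ∀ n : ℕ, N ≤ n → ∀ B : Fin l → ℕ, Antitone B →
      (∑ i, B i) = n * (∑ i, A i) → Dom l (fun i => n * A i) B →
      0 < schurMult l B ((schur l A) ^ n) := by
  exact main_thm l hl A hA
end

section
/- Let A ≻ B be partitions of equal weight with |Y(A) \ Y(B)| = k. Then there exists a sequence of partitions P^0 = A, P^1, …, P^k = B, all of the same weight, such that P^0 ≻ P^1 ≻ ⋯ ≻ P^k, |Y(P^i) \ Y(P^{i+1})| = 1 for all 0 ≤ i < k, and for all 0 ≤ i < j ≤ k one has Y(P^i) \ Y(P^j) ⊆ Y(A) \ Y(B) and Y(P^j) \ Y(P^i) ⊆ Y(B) \ Y(A). -/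
open Finset MvPolynomial

lemma step_exists (l : ℕ) (A B : Fin l → ℕ)
    (hA : Antitone A) (hB : Antitone B) (hw : ∑ i, A i = ∑ i, B i)
    (hdom : Dom l A B) (hne : A ≠ B) :
    ∃ (C : Fin l → ℕ) (p q : Fin l), p < q ∧ B p < A p ∧ A q < B q ∧
      (∀ i, C i + (if i = p then 1 else 0) = A i + (if i = q then 1 else 0)) ∧
      Antitone C ∧ Dom l C B := by
  classical
  have hex : ∃ q, A q < B q := by
    by_contra! h
    apply hne
    have := (Finset.sum_eq_sum_iff_of_le (s := Finset.univ) (f := B) (g := A)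
      (fun i _ => h i)).1 hw.symm
    funext i
    exact (this i (Finset.mem_univ i)).symm
  obtain ⟨q, hq, hqmin⟩ : ∃ q, A q < B q ∧ ∀ i, i < q → B i ≤ A i := by
    obtain ⟨q, hq⟩ := (Set.toFinite {q | A q < B q}).exists_minimal hex
    refine ⟨q, hq.1, fun i hi => ?_⟩
    by_contra! h
    exact absurd (hq.2 h hi.le) (not_le.2 hi)
  have hexp : ∃ p, p < q ∧ B p < A p := by
    by_contra! h
    have h1 := hdom ((q : ℕ) + 1)
    have h2 : ∑ i ∈ Finset.univ.filter (fun i : Fin l => (i : ℕ) < (q : ℕ) + 1), A i <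
        ∑ i ∈ Finset.univ.filter (fun i : Fin l => (i : ℕ) < (q : ℕ) + 1), B i := by
      apply Finset.sum_lt_sum
      · intro i hi
        simp only [Finset.mem_filter, Finset.mem_univ, true_and] at hi
        rcases eq_or_ne i q with rfl | hiq
        · exact hq.le
        · apply h
          have : (i : ℕ) ≠ q := fun h => hiq (Fin.ext h)
          exact Fin.lt_def.2 (by omega)
      · exact ⟨q, by simp, hq⟩
    omega
  obtain ⟨p, ⟨hpq, hp⟩, hpmax⟩ : ∃ p, (p < q ∧ B p < A p) ∧ ∀ i, p < i → i < q → A i ≤ B i := by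
    obtain ⟨p, hp⟩ := (Set.toFinite {p | p < q ∧ B p < A p}).exists_maximal hexp
    refine ⟨p, hp.1, fun i hi hiq => ?_⟩
    by_contra! h
    exact absurd (hp.2 ⟨hiq, h⟩ hi.le) (not_le.2 hi)
  have hC : ∀ i, (A i + (if i = q then 1 else 0) - (if i = p then 1 else 0)) +
      (if i = p then 1 else 0) = A i + (if i = q then 1 else 0) := by
    intro i
    apply Nat.sub_add_cancel
    by_cases h : i = p
    · subst h; simp; omega
    · simp [h]
  refine ⟨fun i => A i + (if i = q then 1 else 0) - (if i = p then 1 else 0), p, q, hpq, hp, hq,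
    hC, ?_, ?_⟩
  · intro i j hij
    rcases hij.eq_or_lt with rfl | hij
    · exact le_rfl
    have hAij := hA hij.le
    have hBij := hB hij.le
    show A j + (if j = q then 1 else 0) - (if j = p then 1 else 0) ≤
      A i + (if i = q then 1 else 0) - (if i = p then 1 else 0)
    by_cases hip : i = p
    · subst hip
      have e1 : ¬ i = q := hpq.ne
      have e2 : ¬ j = i := hij.ne'
      simp only [e1, e2, if_true, if_false]
      by_cases hjq : j = q
      · subst hjq; simp; omega
      · simp only [hjq, if_false]
        rcases lt_or_gt_of_ne hjq with h | h
        · have := hpmax j hij h; omega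
        · have := hA h.le; have := hB hpq.le; omega
    · by_cases hjq : j = q
      · subst hjq
        have e1 : ¬ i = j := hij.ne
        have e2 : ¬ j = p := hpq.ne'
        simp only [e1, e2, hip, if_true, if_false]
        have := hqmin i hij
        omega
      · simp only [hip, hjq, if_false]
        omega
  · intro r
    have h1 := Finset.sum_congr (s₁ := Finset.univ.filter (fun i : Fin l => (i : ℕ) < r)) rfl
      (fun i _ => hC i)
    rw [Finset.sum_add_distrib, Finset.sum_add_distrib, Finset.sum_ite_eq', Finset.sum_ite_eq'] at h1
    simp only [Finset.mem_filter, Finset.mem_univ, true_and] at h1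
    have h0 := hdom r
    beta_reduce
    have hpq' : (p : ℕ) < q := hpq
    by_cases hrq : (q : ℕ) < r
    · rw [if_pos hrq, if_pos (by omega)] at h1
      omega
    · rw [if_neg hrq] at h1
      by_cases hrp : (p : ℕ) < r
      · rw [if_pos hrp] at h1
        have : ∑ i ∈ Finset.univ.filter (fun i : Fin l => (i : ℕ) < r), B i <
            ∑ i ∈ Finset.univ.filter (fun i : Fin l => (i : ℕ) < r), A i := by
          apply Finset.sum_lt_sum
          · intro i hi
            simp only [Finset.mem_filter, Finset.mem_univ, true_and] at hi
            exact hqmin i (Fin.lt_def.2 (by omega))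
          · exact ⟨p, by simpa using hrp, hp⟩
        omega
      · rw [if_neg hrp] at h1
        omega

lemma yd_diff_finite (l : ℕ) (A B : Fin l → ℕ) : (YD l A \ YD l B).Finite := by
  apply Set.Finite.subset (Set.finite_univ.prod (Set.finite_lt_nat (∑ i, A i)))
  rintro ⟨i, n⟩ ⟨h, -⟩
  exact ⟨trivial, lt_of_lt_of_le h (Finset.single_le_sum (fun _ _ => Nat.zero_le _)
    (Finset.mem_univ i))⟩

lemma interp_aux (l k : ℕ) (B : Fin l → ℕ) (hB : Antitone B) : ∀ (A : Fin l → ℕ)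
    (hA : Antitone A) (hw : ∑ i, A i = ∑ i, B i)
    (hdom : Dom l A B) (hk : (YD l A \ YD l B).ncard = k),
    ∃ P : ℕ → Fin l → ℕ, P 0 = A ∧ P k = B ∧
      (∀ i, i ≤ k → Antitone (P i)) ∧
      (∀ i, i ≤ k → ∑ j, P i j = ∑ j, A j) ∧
      (∀ i, i < k → Dom l (P i) (P (i + 1)) ∧ P i ≠ P (i + 1) ∧
        (YD l (P i) \ YD l (P (i + 1))).ncard = 1) ∧
      (∀ i j, i < j → j ≤ k →
        (YD l (P i) \ YD l (P j)) ⊆ (YD l A \ YD l B) ∧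
        (YD l (P j) \ YD l (P i)) ⊆ (YD l B \ YD l A)) := by
  induction k with
  | zero =>
    intro A hA hw hdom hk
    have hAB : A = B := by
      rw [Set.ncard_eq_zero (yd_diff_finite l A B)] at hk
      have hle : ∀ i, A i ≤ B i := by
        intro i
        by_contra! h
        have : (i, B i) ∈ YD l A \ YD l B := ⟨h, lt_irrefl (B i)⟩
        rw [hk] at this
        exact this
      have := (Finset.sum_eq_sum_iff_of_le (s := Finset.univ) (f := A) (g := B)
        (fun i _ => hle i)).1 hw
      funext i
      exact this i (Finset.mem_univ i)
    subst hAB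
    exact ⟨fun _ => A, rfl, rfl, fun _ _ => hA, fun _ _ => rfl, fun i hi => absurd hi (by omega),
      fun i j hi hj => absurd hi (by omega)⟩
  | succ k ih =>
    intro A hA hw hdom hk
    have hne : A ≠ B := by
      rintro rfl
      simp at hk
    obtain ⟨C, p, q, hpq, hp, hq, hC, hCa, hCd⟩ := step_exists l A B hA hB hw hdom hne
    have hsum : ∑ i, C i = ∑ i, A i := by
      have h1 := Finset.sum_congr (s₁ := Finset.univ) rfl (fun i _ => hC i)
      rw [Finset.sum_add_distrib, Finset.sum_add_distrib, Finset.sum_ite_eq',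
        Finset.sum_ite_eq'] at h1
      simpa using h1
    have hCp : C p + 1 = A p := by
      have := hC p
      simpa [hpq.ne] using this
    have hCq : C q = A q + 1 := by
      have := hC q
      simpa [hpq.ne'] using this
    have hCo : ∀ i, i ≠ p → i ≠ q → C i = A i := by
      intro i h1 h2
      have := hC i
      simpa [h1, h2] using this
    have hcase : ∀ i, i = p ∨ i = q ∨ C i = A i := by
      intro i
      by_cases h1 : i = p
      · exact Or.inl h1
      by_cases h2 : i = q
      · exact Or.inr (Or.inl h2)
      exact Or.inr (Or.inr (hCo i h1 h2))
    have hAC : YD l A \ YD l C = {(p, C p)} := by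
      ext ⟨i, n⟩
      simp only [YD, Set.mem_diff, Set.mem_setOf_eq, Set.mem_singleton_iff, Prod.mk.injEq]
      constructor
      · rintro ⟨h1, h2⟩
        rcases hcase i with rfl | rfl | h
        · exact ⟨rfl, by omega⟩
        · omega
        · omega
      · rintro ⟨rfl, rfl⟩
        omega
    have hABC : YD l A \ YD l B = insert (p, C p) (YD l C \ YD l B) := by
      ext ⟨i, n⟩
      simp only [YD, Set.mem_diff, Set.mem_setOf_eq, Set.mem_insert_iff, Prod.mk.injEq]
      constructor
      · rintro ⟨h1, h2⟩
        rcases hcase i with rfl | rfl | h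
        · by_cases hn : n = C i
          · exact Or.inl ⟨rfl, hn⟩
          · right; omega
        · right; omega
        · right; omega
      · rintro (⟨rfl, rfl⟩ | ⟨h1, h2⟩)
        · omega
        · rcases hcase i with rfl | rfl | h <;> omega
    have hCA : YD l C \ YD l A ⊆ YD l B \ YD l A := by
      rintro ⟨i, n⟩ ⟨h1, h2⟩
      refine ⟨?_, h2⟩
      simp only [YD, Set.mem_setOf_eq] at *
      rcases hcase i with rfl | rfl | h <;> omega
    have hBC : YD l B \ YD l C ⊆ YD l B \ YD l A := by
      rintro ⟨i, n⟩ ⟨h1, h2⟩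
      refine ⟨h1, ?_⟩
      simp only [YD, Set.mem_setOf_eq] at *
      rcases hcase i with rfl | rfl | h <;> omega
    have hCB : YD l C \ YD l B ⊆ YD l A \ YD l B := by
      rw [hABC]; exact Set.subset_insert _ _
    have hAC' : YD l A \ YD l C ⊆ YD l A \ YD l B := by
      rw [hAC, hABC]
      rintro x rfl
      exact Set.mem_insert _ _
    have hk' : (YD l C \ YD l B).ncard = k := by
      rw [hABC, Set.ncard_insert_of_notMem _ (yd_diff_finite l C B)] at hk
      · omega
      · rintro ⟨h, -⟩
        exact lt_irrefl (C p) h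
    obtain ⟨P, hP0, hPk, hPa, hPs, hPd, hPi⟩ := ih C hCa (hsum.trans hw) hCd hk'
    have hPi' : ∀ j, j ≤ k → (YD l C \ YD l (P j)) ⊆ (YD l C \ YD l B) ∧
        (YD l (P j) \ YD l C) ⊆ (YD l B \ YD l C) := by
      intro j hj
      rcases Nat.eq_zero_or_pos j with rfl | h
      · rw [hP0]; simp
      · have := hPi 0 j h hj
        rwa [hP0] at this
    refine ⟨fun n => Nat.casesOn n A P, rfl, hPk, ?_, ?_, ?_, ?_⟩
    · rintro (_ | i) hi
      · exact hA
      · exact hPa i (by omega)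
    · rintro (_ | i) hi
      · rfl
      · exact (hPs i (by omega)).trans hsum
    · rintro (_ | i) hi
      · show Dom l A (P 0) ∧ A ≠ P 0 ∧ (YD l A \ YD l (P 0)).ncard = 1
        rw [hP0]
        refine ⟨?_, ?_, ?_⟩
        · intro r
          have h1 := Finset.sum_congr (s₁ := Finset.univ.filter (fun i : Fin l => (i : ℕ) < r)) rfl
            (fun i _ => hC i)
          rw [Finset.sum_add_distrib, Finset.sum_add_distrib, Finset.sum_ite_eq',
            Finset.sum_ite_eq'] at h1
          simp only [Finset.mem_filter, Finset.mem_univ, true_and] at h1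
          have hpq' : (p : ℕ) < q := hpq
          split_ifs at h1 <;> omega
        · rintro rfl
          omega
        · rw [hAC, Set.ncard_singleton]
      · exact hPd i (by omega)
    · rintro (_ | i) (_ | j) hij hj
      · omega
      · obtain ⟨h1, h2⟩ := hPi' j (by omega)
        constructor
        · rintro x ⟨hx1, hx2⟩
          by_cases hx : x ∈ YD l C
          · exact hCB (h1 ⟨hx, hx2⟩)
          · exact hAC' ⟨hx1, hx⟩
        · rintro x ⟨hx1, hx2⟩
          by_cases hx : x ∈ YD l C
          · exact hCA ⟨hx, hx2⟩
          · exact hBC (h2 ⟨hx1, hx⟩)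
      · omega
      · obtain ⟨h1, h2⟩ := hPi i j (by omega) (by omega)
        exact ⟨h1.trans hCB, h2.trans hBC⟩

/-- If `A ≻ B` are partitions of equal weight with
`|Y(A) \ Y(B)| = k`, there is an interpolating sequence `P 0 = A, …, P k = B` of
partitions of the same weight, strictly decreasing in the dominance order, with
consecutive terms at distance `1`, and with `Y(P i) \ Y(P j) ⊆ Y(A) \ Y(B)` and
`Y(P j) \ Y(P i) ⊆ Y(B) \ Y(A)` for `i < j`. -/
theorem dominance_interpolating_sequence (l k : ℕ) (A B : Fin l → ℕ)
    (hA : Antitone A) (hB : Antitone B) (hw : ∑ i, A i = ∑ i, B i)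
    (hdom : Dom l A B) (hne : A ≠ B) (hk : (YD l A \ YD l B).ncard = k) :
    ∃ P : ℕ → Fin l → ℕ, P 0 = A ∧ P k = B ∧
      (∀ i, i ≤ k → Antitone (P i)) ∧
      (∀ i, i ≤ k → ∑ j, P i j = ∑ j, A j) ∧
      (∀ i, i < k → Dom l (P i) (P (i + 1)) ∧ P i ≠ P (i + 1) ∧
        (YD l (P i) \ YD l (P (i + 1))).ncard = 1) ∧
      (∀ i j, i < j → j ≤ k →
        (YD l (P i) \ YD l (P j)) ⊆ (YD l A \ YD l B) ∧
        (YD l (P j) \ YD l (P i)) ⊆ (YD l B \ YD l A)) := by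
  exact interp_aux l k B hB A hA hw hdom hk
end
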